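/- arXiv:0902.0390 — 2 statements merged into one kernel-verified Lean document; each statement's English description precedes it below -/
import Mathlib

section
/- Let 0 < r < R < ∞ and suppose the coefficients depend only on x_1: A^{αβ}(t,x) = Ā^{αβ}(x_1). Suppose u : ℝ^{1+d} → ℝ^m is smooth and satisfies −u_t + D_α(A^{αβ}D_βu) = 0 weakly in Q_R. Then for all nonnegative integers i, j with i + j ≥ 1 and every partial derivative D_{x'}^j of order j taken only with respect to the variables x_2,…,x_d, one has ‖∂_t^i D_{x'}^j u‖_{L_2(Q_r)} + ‖∂_t^i D_{x'}^j D_1 u‖_{L_2(Q_r)} ≤ N ‖Du‖_{L_2(Q_R)}, where N = N(d,m,δ,R,r,i,j). -/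
open MeasureTheory Metric Set Function
open scoped ENNReal NNReal RealInnerProductSpace BigOperators

noncomputable section

/-- `ℝ^d` with the Euclidean norm. -/
abbrev Ed (d : ℕ) : Type := EuclideanSpace ℝ (Fin d)
/-- `ℝ^m` with the Euclidean norm. -/
abbrev Em (m : ℕ) : Type := EuclideanSpace ℝ (Fin m)
/-- `m × m` real matrices, viewed as linear operators on `ℝ^m`. -/
abbrev CLM (m : ℕ) : Type := Em m →L[ℝ] Em m

/-- Spatial partial derivative `D_α u` of a function on `ℝ^{1+d}`. -/
def pd {d : ℕ} {F : Type*} [NormedAddCommGroup F] [NormedSpace ℝ F]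
    (α : Fin d) (u : ℝ × Ed d → F) (q : ℝ × Ed d) : F :=
  fderiv ℝ u q (0, EuclideanSpace.single α 1)

/-- Time derivative `∂_t u` of a function on `ℝ^{1+d}`. -/
def pt {d : ℕ} {F : Type*} [NormedAddCommGroup F] [NormedSpace ℝ F]
    (u : ℝ × Ed d → F) (q : ℝ × Ed d) : F :=
  fderiv ℝ u q (1, 0)

/-- `|Du|²`, the squared Euclidean norm of the spatial gradient. -/
def gradSq {d m : ℕ} (u : ℝ × Ed d → Em m) (q : ℝ × Ed d) : ℝ :=
  ∑ α, ‖pd α u q‖ ^ 2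

/-- The parabolic cylinder `Q_r(t,x) = (t - r², t) × B_r(x)`. -/
def Qc {d : ℕ} (r t : ℝ) (x : Ed d) : Set (ℝ × Ed d) :=
  Ioo (t - r ^ 2) t ×ˢ ball x r

/-- `Q_r = Q_r(0,0)`. -/
def Qc0 {d : ℕ} (r : ℝ) : Set (ℝ × Ed d) := Qc r 0 0

/-- Boundedness by `δ⁻¹` together with the ellipticity condition with constant `δ`
for a family of `m × m` matrices. -/
def EllipticPt (δ : ℝ) {d m : ℕ} (a : Fin d → Fin d → CLM m) : Prop :=
  (∀ α β, ‖a α β‖ ≤ δ⁻¹) ∧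
  ∀ ξ : Fin d → Em m, δ * ∑ α, ‖ξ α‖ ^ 2 ≤ ∑ α, ∑ β, ⟪ξ α, a α β (ξ β)⟫

/-- Measurable, bounded, uniformly elliptic coefficients on `ℝ^{1+d}`. -/
def Coeffs (δ : ℝ) {d m : ℕ} (A : Fin d → Fin d → ℝ × Ed d → CLM m) : Prop :=
  (∀ α β, Measurable (A α β)) ∧ ∀ q, EllipticPt δ (fun α β => A α β q)

/-- The class `𝒜`: measurable, bounded, uniformly elliptic coefficients depending on
one real variable. -/
def CoeffsOne (δ : ℝ) {d m : ℕ} (Ab : Fin d → Fin d → ℝ → CLM m) : Prop :=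
  (∀ α β, Measurable (Ab α β)) ∧ ∀ s, EllipticPt δ (fun α β => Ab α β s)

/-- The class `Ψ` of `C^{1,1}` diffeomorphisms of `ℝ^d`: `ψ` and its inverse `φ`
are `C^1` with Lipschitz first derivatives, and `|Dψ| + |D²ψ| ≤ δ⁻¹`,
`|Dφ| + |D²φ| ≤ δ⁻¹` (where the second derivative is measured by the Lipschitz
constant of the first derivative). -/
def IsPsi (δ : ℝ) {d : ℕ} (ψ φ : Ed d → Ed d) : Prop :=
  Function.LeftInverse φ ψ ∧ Function.RightInverse φ ψ ∧
  ContDiff ℝ 1 ψ ∧ ContDiff ℝ 1 φ ∧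
  ∃ K K' : ℝ≥0, LipschitzWith K (fderiv ℝ ψ) ∧ LipschitzWith K' (fderiv ℝ φ) ∧
    (∀ x, ‖fderiv ℝ ψ x‖ + (K : ℝ) ≤ δ⁻¹) ∧ ∀ y, ‖fderiv ℝ φ y‖ + (K' : ℝ) ≤ δ⁻¹

/-! ### Auxiliary material -/

/-- Directional derivative. -/
def dw {d : ℕ} {F : Type*} [NormedAddCommGroup F] [NormedSpace ℝ F]
    (w : ℝ × Ed d) (u : ℝ × Ed d → F) (q : ℝ × Ed d) : F := fderiv ℝ u q w

section aux
variable {d m : ℕ} {F : Type*} [NormedAddCommGroup F] [NormedSpace ℝ F]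

lemma pd_eq (α : Fin d) (u : ℝ × Ed d → F) : pd α u = dw (0, EuclideanSpace.single α 1) u := rfl
lemma pt_eq (u : ℝ × Ed d → F) : pt u = dw (1, 0) u := rfl

lemma smooth_dw {u : ℝ × Ed d → F} (w : ℝ × Ed d) (hu : ContDiff ℝ (⊤ : ℕ∞) u) :
    ContDiff ℝ (⊤ : ℕ∞) (dw w u) := by
  unfold dw
  have h : ContDiff ℝ (⊤ : ℕ∞) (fderiv ℝ u) := hu.fderiv_right (by simp)
  exact h.clm_apply contDiff_const

lemma smooth_pd {u : ℝ × Ed d → F} (α : Fin d) (hu : ContDiff ℝ (⊤ : ℕ∞) u) :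
    ContDiff ℝ (⊤ : ℕ∞) (pd α u) := smooth_dw _ hu
lemma smooth_pt {u : ℝ × Ed d → F} (hu : ContDiff ℝ (⊤ : ℕ∞) u) :
    ContDiff ℝ (⊤ : ℕ∞) (pt u) := smooth_dw _ hu

lemma dw_comm {u : ℝ × Ed d → F} (a b : ℝ × Ed d) (hu : ContDiff ℝ (⊤ : ℕ∞) u) :
    dw a (dw b u) = dw b (dw a u) := by
  funext q
  have h : ContDiff ℝ (⊤ : ℕ∞) (fderiv ℝ u) := hu.fderiv_right (by simp)
  have hd : DifferentiableAt ℝ (fderiv ℝ u) q := (h.differentiable (by simp)) q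
  have key : ∀ a b : ℝ × Ed d, dw a (dw b u) q = fderiv ℝ (fderiv ℝ u) q a b := by
    intro a b
    unfold dw
    rw [fderiv_clm_apply hd (differentiableAt_const b)]
    simp
  rw [key, key]
  have hs : IsSymmSndFDerivAt ℝ u q := hu.contDiffAt.isSymmSndFDerivAt (by
    simp only [minSmoothness_of_isRCLikeNormedField]; exact WithTop.coe_le_coe.2 (le_top : (2 : ℕ∞) ≤ ⊤))
  exact hs.eq a b

lemma hcs_dw {u : ℝ × Ed d → F} (w : ℝ × Ed d) (hu : HasCompactSupport u) :
    HasCompactSupport (dw w u) := HasCompactSupport.fderiv_apply (𝕜 := ℝ) hu w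

lemma tsupport_dw {u : ℝ × Ed d → F} (w : ℝ × Ed d) :
    tsupport (dw w u) ⊆ tsupport u := tsupport_fderiv_apply_subset ℝ w

lemma dw_zero_off {u : ℝ × Ed d → F} (w : ℝ × Ed d) {q : ℝ × Ed d} (hq : q ∉ tsupport u) :
    dw w u q = 0 := image_eq_zero_of_notMem_tsupport (fun h => hq (tsupport_dw w h))

lemma dw_smul {f : ℝ × Ed d → ℝ} {u : ℝ × Ed d → F} (w q : ℝ × Ed d)
    (hf : ContDiff ℝ (⊤ : ℕ∞) f) (hu : ContDiff ℝ (⊤ : ℕ∞) u) :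
    dw w (fun q => f q • u q) q = f q • dw w u q + dw w f q • u q := by
  unfold dw
  rw [fderiv_fun_smul ((hf.differentiable (by simp)) q) ((hu.differentiable (by simp)) q)]
  simp

lemma meas_term {B : ℝ × Ed d → CLM m} (hB : Measurable B) {g ψ : ℝ × Ed d → Em m}
    (hg : Continuous g) (hψ : Continuous ψ) :
    AEStronglyMeasurable (fun q => ⟪B q (g q), ψ q⟫) volume := by
  have h1 : StronglyMeasurable B := hB.stronglyMeasurable
  have h2 : Continuous (fun p : (CLM m × Em m) × Em m => ⟪p.1.1 p.1.2, p.2⟫) := by fun_prop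
  exact (h2.comp_stronglyMeasurable
    ((h1.prodMk hg.stronglyMeasurable).prodMk hψ.stronglyMeasurable)).aestronglyMeasurable

lemma int_term {B : ℝ × Ed d → CLM m} (hB : Measurable B) {C : ℝ} (hC : ∀ q, ‖B q‖ ≤ C)
    {g ψ : ℝ × Ed d → Em m} (hg : Continuous g) (hψ : Continuous ψ)
    (hs : HasCompactSupport ψ) : Integrable (fun q => ⟪B q (g q), ψ q⟫) := by
  have hC0 : 0 ≤ C := (norm_nonneg _).trans (hC 0)
  have hI : Integrable (fun q => C * ‖g q‖ * ‖ψ q‖) := by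
    apply Continuous.integrable_of_hasCompactSupport (by fun_prop)
    exact hs.norm.mul_left
  refine hI.mono' (meas_term hB hg hψ) (Filter.Eventually.of_forall fun q => ?_)
  calc ‖⟪B q (g q), ψ q⟫‖ ≤ ‖B q (g q)‖ * ‖ψ q‖ := norm_inner_le_norm _ _
    _ ≤ (‖B q‖ * ‖g q‖) * ‖ψ q‖ := by gcongr; exact (B q).le_opNorm _
    _ ≤ _ := by gcongr; exact hC q

lemma ibp {B : ℝ × Ed d → CLM m} (hB : Measurable B) {C : ℝ} (hC : ∀ q, ‖B q‖ ≤ C)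
    {w : ℝ × Ed d} (hw : ∀ (q : ℝ × Ed d) (s : ℝ), B (q + s • w) = B q)
    {g ψ : ℝ × Ed d → Em m} (hg : ContDiff ℝ (⊤ : ℕ∞) g) (hψ : ContDiff ℝ (⊤ : ℕ∞) ψ)
    (hs : HasCompactSupport ψ) :
    ∫ q, ⟪B q (g q), dw w ψ q⟫ = - ∫ q, ⟪B q (dw w g q), ψ q⟫ := by
  have hg' := (smooth_dw w hg).continuous
  have hψ' := (smooth_dw w hψ).continuous
  have : (volume : Measure (ℝ × Ed d)).IsAddHaarMeasure :=
    inferInstanceAs (Measure.prod volume volume).IsAddHaarMeasure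
  refine integral_bilinear_hasLineDerivAt_right_eq_neg_left_of_integrable (μ := volume)
    (f := fun q => B q (g q)) (f' := fun q => B q (dw w g q)) (g := ψ) (g' := dw w ψ)
    (v := w) (B := innerSL ℝ) ?_ ?_ ?_ ?_ ?_
  · exact int_term hB hC hg' hψ.continuous hs
  · exact int_term hB hC hg.continuous hψ' (hcs_dw w hs)
  · exact int_term hB hC hg.continuous hψ.continuous hs
  · intro q _
    have h1 : HasLineDerivAt ℝ g (dw w g q) q w :=
      ((hg.differentiable (by simp)) q).hasFDerivAt.hasLineDerivAt w
    unfold HasLineDerivAt at h1 ⊢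
    simp only [hw]
    exact (B q).hasFDerivAt.comp_hasDerivAt _ h1
  · intro q _
    exact ((hψ.differentiable (by simp)) q).hasFDerivAt.hasLineDerivAt w

end aux

/-- Smooth weak solutions in `Q_R`. -/
def Sol {d m : ℕ} [NeZero d] (Ab : Fin d → Fin d → ℝ → CLM m) (R : ℝ)
    (u : ℝ × Ed d → Em m) : Prop :=
  ContDiff ℝ (⊤ : ℕ∞) u ∧
    ∀ φt : ℝ × Ed d → Em m, ContDiff ℝ (⊤ : ℕ∞) φt → HasCompactSupport φt →
      tsupport φt ⊆ Qc0 R →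
      ∫ q, (⟪u q, pt φt q⟫ - ∑ α, ∑ β, ⟪Ab α β (q.2 0) (pd β u q), pd α φt q⟫) = 0

section sol
variable {d m : ℕ} [NeZero d] {δ : ℝ} {Ab : Fin d → Fin d → ℝ → CLM m}

lemma meas_Ab (hA : CoeffsOne δ Ab) (α β : Fin d) :
    Measurable (fun q : ℝ × Ed d => Ab α β (q.2 0)) := by
  have : Measurable (fun q : ℝ × Ed d => q.2 0) := by
    have : Continuous (fun q : ℝ × Ed d => q.2 0) := by fun_prop
    exact this.measurable
  exact (hA.1 α β).comp this

lemma Sol.mono {R ρ : ℝ} {u : ℝ × Ed d → Em m} (h : Sol Ab R u) (hρ : 0 < ρ) (hR : ρ ≤ R) :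
    Sol Ab ρ u := by
  refine ⟨h.1, fun φ h1 h2 h3 => h.2 φ h1 h2 (h3.trans ?_)⟩
  unfold Qc0 Qc
  have : ρ ^ 2 ≤ R ^ 2 := by gcongr
  exact Set.prod_mono (Ioo_subset_Ioo (by linarith) le_rfl) (ball_subset_ball hR)

/-- splitting the weak formulation -/
lemma weak_split (hA : CoeffsOne δ Ab) {u φ : ℝ × Ed d → Em m}
    (hu : ContDiff ℝ (⊤ : ℕ∞) u) (hφ : ContDiff ℝ (⊤ : ℕ∞) φ) (hs : HasCompactSupport φ) :
    ∫ q, (⟪u q, pt φ q⟫ - ∑ α, ∑ β, ⟪Ab α β (q.2 0) (pd β u q), pd α φ q⟫)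
      = (∫ q, ⟪u q, pt φ q⟫)
        - ∑ α, ∑ β, ∫ q, ⟪Ab α β (q.2 0) (pd β u q), pd α φ q⟫ := by
  have h1 : Integrable (fun q => ⟪u q, pt φ q⟫) :=
    int_term (B := fun _ => ContinuousLinearMap.id ℝ (Em m)) measurable_const
      (fun _ => ContinuousLinearMap.norm_id_le) hu.continuous (smooth_pt hφ).continuous
      (hcs_dw _ hs)
  have h2 : ∀ α β, Integrable (fun q : ℝ × Ed d => ⟪Ab α β (q.2 0) (pd β u q), pd α φ q⟫) :=
    fun α β => int_term (meas_Ab hA α β) (fun q => (hA.2 _).1 α β)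
      (smooth_pd β hu).continuous (smooth_pd α hφ).continuous (hcs_dw _ hs)
  rw [integral_sub h1 (integrable_finsetSum _ fun α _ => integrable_finsetSum _ fun β _ => h2 α β)]
  congr 1
  rw [integral_finsetSum _ (fun α _ => integrable_finsetSum _ fun β _ => h2 α β)]
  exact Finset.sum_congr rfl fun α _ => integral_finsetSum _ fun β _ => h2 α β

lemma Sol.dw (hA : CoeffsOne δ Ab) {R : ℝ} {u : ℝ × Ed d → Em m} (h : Sol Ab R u)
    {w : ℝ × Ed d} (hw : w.2 0 = 0) : Sol Ab R (dw w u) := by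
  refine ⟨smooth_dw w h.1, fun φ h1 h2 h3 => ?_⟩
  have hφ := smooth_dw w h1
  have key := h.2 (_root_.dw w φ) hφ (hcs_dw w h2) ((tsupport_dw w).trans h3)
  rw [weak_split hA h.1 hφ (hcs_dw w h2)] at key
  rw [weak_split hA (smooth_dw w h.1) h1 h2]
  have e1 : ∫ q, ⟪u q, pt (_root_.dw w φ) q⟫ = - ∫ q, ⟪_root_.dw w u q, pt φ q⟫ := by
    have := ibp (B := fun _ => ContinuousLinearMap.id ℝ (Em m)) measurable_const
      (fun _ => ContinuousLinearMap.norm_id_le) (w := w) (fun _ _ => rfl) h.1 (smooth_pt h1)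
      (hcs_dw _ h2)
    rw [pt_eq, dw_comm _ _ h1]
    exact this
  have e2 : ∀ α β, ∫ q : ℝ × Ed d, ⟪Ab α β (q.2 0) (pd β u q), pd α (_root_.dw w φ) q⟫
      = - ∫ q : ℝ × Ed d, ⟪Ab α β (q.2 0) (pd β (_root_.dw w u) q), pd α φ q⟫ := by
    intro α β
    have := ibp (meas_Ab hA α β) (fun q => (hA.2 _).1 α β) (w := w)
      (fun q s => by simp [hw]) (smooth_pd β h.1) (smooth_pd α h1)
      (hcs_dw _ h2)
    rw [pd_eq α (_root_.dw w φ), dw_comm _ _ h1, pd_eq β (_root_.dw w u), dw_comm _ _ h.1]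
    exact this
  simp only [e1, e2, Finset.sum_neg_distrib] at key
  linarith

end sol

section weak
variable {d m : ℕ} {δ : ℝ} {Ab : Fin d → Fin d → ℝ → CLM m}

/-- The weak-form integrand, with the time derivative on `u`. -/
def Gf [NeZero d] (Ab : Fin d → Fin d → ℝ → CLM m) (u φ : ℝ × Ed d → Em m) (q : ℝ × Ed d) : ℝ :=
  ⟪pt u q, φ q⟫ + ∑ α, ∑ β, ⟪Ab α β (q.2 0) (pd β u q), pd α φ q⟫

lemma int_G [NeZero d] (hA : CoeffsOne δ Ab) {u φ : ℝ × Ed d → Em m}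
    (hu : ContDiff ℝ (⊤ : ℕ∞) u) (hφ : ContDiff ℝ (⊤ : ℕ∞) φ) (hs : HasCompactSupport φ) :
    Integrable (Gf Ab u φ) := by
  have h1 : Integrable (fun q => ⟪pt u q, φ q⟫) :=
    int_term (B := fun _ => ContinuousLinearMap.id ℝ (Em m)) measurable_const
      (fun _ => ContinuousLinearMap.norm_id_le) (smooth_pt hu).continuous hφ.continuous hs
  have h2 : ∀ α β, Integrable (fun q : ℝ × Ed d => ⟪Ab α β (q.2 0) (pd β u q), pd α φ q⟫) :=
    fun α β => int_term (meas_Ab hA α β) (fun q => (hA.2 _).1 α β)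
      (smooth_pd β hu).continuous (smooth_pd α hφ).continuous (hcs_dw _ hs)
  exact h1.add (integrable_finsetSum _ fun α _ => integrable_finsetSum _ fun β _ => h2 α β)

lemma weak_t [NeZero d] (hA : CoeffsOne δ Ab) {R : ℝ} {u φ : ℝ × Ed d → Em m} (h : Sol Ab R u)
    (hφ : ContDiff ℝ (⊤ : ℕ∞) φ) (hs : HasCompactSupport φ) (hsub : tsupport φ ⊆ Qc0 R) :
    ∫ q, Gf Ab u φ q = 0 := by
  have key := h.2 φ hφ hs hsub
  have hu := h.1
  have h0 : Integrable (fun q => ⟪u q, pt φ q⟫) :=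
    int_term (B := fun _ => ContinuousLinearMap.id ℝ (Em m)) measurable_const
      (fun _ => ContinuousLinearMap.norm_id_le) hu.continuous (smooth_pt hφ).continuous
      (hcs_dw _ hs)
  have h1 : Integrable (fun q => ⟪pt u q, φ q⟫) :=
    int_term (B := fun _ => ContinuousLinearMap.id ℝ (Em m)) measurable_const
      (fun _ => ContinuousLinearMap.norm_id_le) (smooth_pt hu).continuous hφ.continuous hs
  have h2 : Integrable (fun q : ℝ × Ed d =>
      ∑ α, ∑ β, ⟪Ab α β (q.2 0) (pd β u q), pd α φ q⟫) :=
    integrable_finsetSum _ fun α _ => integrable_finsetSum _ fun β _ =>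
      int_term (meas_Ab hA α β) (fun q => (hA.2 _).1 α β)
      (smooth_pd β hu).continuous (smooth_pd α hφ).continuous (hcs_dw _ hs)
  have e1 : ∫ q, ⟪u q, pt φ q⟫ = - ∫ q, ⟪pt u q, φ q⟫ :=
    ibp (B := fun _ => ContinuousLinearMap.id ℝ (Em m)) measurable_const
      (fun _ => ContinuousLinearMap.norm_id_le) (w := (1, 0)) (fun _ _ => rfl) hu hφ hs
  rw [integral_sub h0 h2] at key
  unfold Gf
  rw [integral_add h1 h2]
  linarith

/-- time cutoffs -/
def chi (n : ℕ) (q : ℝ × Ed d) : ℝ := Real.smoothTransition (-((n : ℝ) + 1) * q.1 - 1)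

lemma chi_smooth (n : ℕ) : ContDiff ℝ (⊤ : ℕ∞) (chi (d := d) n) := by
  unfold chi
  exact Real.smoothTransition.contDiff.comp (by fun_prop)

lemma pd_chi (n : ℕ) (α : Fin d) (q : ℝ × Ed d) : pd α (chi (d := d) n) q = 0 := by
  have := ((chi_smooth (d := d) n).differentiable (by simp) q).lineDeriv_eq_fderiv
    (v := (0, EuclideanSpace.single α 1))
  unfold pd
  rw [← this]
  unfold lineDeriv chi
  simp

lemma weakQ [NeZero d] (hA : CoeffsOne δ Ab) {R : ℝ} {u φ : ℝ × Ed d → Em m} (h : Sol Ab R u)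
    (hφ : ContDiff ℝ (⊤ : ℕ∞) φ) (hs : HasCompactSupport φ)
    (hsub : tsupport φ ⊆ Ioi (-R ^ 2) ×ˢ ball 0 R) :
    ∫ q in Qc0 R, Gf Ab u φ q = 0 := by
  have hQm : MeasurableSet (Qc0 (d := d) R) := measurableSet_Ioo.prod measurableSet_ball
  have hG := int_G hA h.1 hφ hs
  have hn : ∀ n : ℕ, ∫ q, chi n q * Gf Ab u φ q = 0 := by
    intro n
    have hψ : ContDiff ℝ (⊤ : ℕ∞) (fun q => chi n q • φ q) := (chi_smooth n).smul hφ
    have hts : tsupport (fun q => chi n q • φ q) ⊆ tsupport φ :=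
      tsupport_smul_subset_right _ _
    have hts2 : tsupport (fun q => chi (d := d) n q • φ q) ⊆ Iic (-((n : ℝ) + 1)⁻¹) ×ˢ univ := by
      refine closure_minimal ?_ (isClosed_Iic.prod isClosed_univ)
      intro q hq
      by_contra hc
      apply hq
      have h1 : -((n : ℝ) + 1)⁻¹ < q.1 := by simpa using hc
      have : chi n q = 0 := by
        apply Real.smoothTransition.zero_of_nonpos
        have hp : (0 : ℝ) < (n : ℝ) + 1 := by positivity
        have h2 : ((n : ℝ) + 1) * (-((n : ℝ) + 1)⁻¹) < ((n : ℝ) + 1) * q.1 :=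
          mul_lt_mul_of_pos_left h1 hp
        rw [mul_neg, mul_inv_cancel₀ hp.ne'] at h2
        linarith
      simp [this]
    have hcs : HasCompactSupport (fun q => chi n q • φ q) :=
      hs.of_isClosed_subset (isClosed_tsupport _) hts
    have := weak_t hA h hψ hcs (fun q hq => by
      have h1 := hsub (hts hq)
      have h2 := hts2 hq
      have hp : (0 : ℝ) < ((n : ℝ) + 1)⁻¹ := by positivity
      simp only [Set.mem_prod, mem_Ioi, mem_Iic] at h1 h2
      refine ⟨⟨?_, ?_⟩, h1.2⟩
      · linarith [h1.1]
      · linarith [h2.1])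
    rw [← this]
    congr 1
    funext q
    unfold Gf
    have e : ∀ α, pd α (fun q => chi n q • φ q) q = chi n q • pd α φ q := by
      intro α
      have e1 := dw_smul (0, EuclideanSpace.single α 1) q (chi_smooth n) hφ
      have e2 := pd_chi n α q
      rw [pd_eq] at e2 ⊢
      rw [e1, e2]
      simp [pd_eq]
    simp only [e, inner_smul_right, mul_add, Finset.mul_sum]
  have hlim : Filter.Tendsto (fun n : ℕ => ∫ q, chi n q * Gf Ab u φ q) Filter.atTop
      (nhds (∫ q, (Qc0 R).indicator (Gf Ab u φ) q)) := by
    refine tendsto_integral_of_dominated_convergence (fun q => ‖Gf Ab u φ q‖) ?_ hG.norm ?_ ?_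
    · intro n
      exact (chi_smooth n).continuous.aestronglyMeasurable.mul hG.aestronglyMeasurable
    · intro n
      refine Filter.Eventually.of_forall fun q => ?_
      rw [norm_mul]
      have : ‖chi n q‖ ≤ 1 := by
        unfold chi
        rw [Real.norm_of_nonneg (Real.smoothTransition.nonneg _)]
        exact Real.smoothTransition.le_one _
      nlinarith [norm_nonneg (Gf Ab u φ q)]
    · refine Filter.Eventually.of_forall fun q => ?_
      by_cases hq : q ∈ tsupport φ
      · have hq' := hsub hq
        by_cases ht : q.1 < 0
        · have hqQ : q ∈ Qc0 R := by
            refine ⟨⟨?_, ht⟩, hq'.2⟩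
            have : -R ^ 2 < q.1 := hq'.1
            linarith
          rw [indicator_of_mem hqQ]
          obtain ⟨N, hN⟩ := exists_nat_gt (2 / (-q.1))
          apply tendsto_const_nhds.congr'
          filter_upwards [Filter.eventually_ge_atTop N] with n hn
          have : chi n q = 1 := by
            apply Real.smoothTransition.one_of_one_le
            have hp : 0 < -q.1 := by linarith
            rw [div_lt_iff₀ hp] at hN
            have : (N : ℝ) ≤ n := by exact_mod_cast hn
            nlinarith
          rw [this, one_mul]
        · have hqQ : q ∉ Qc0 R := fun hc => ht hc.1.2
          rw [indicator_of_notMem hqQ]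
          have : ∀ n, chi n q = 0 := by
            intro n
            apply Real.smoothTransition.zero_of_nonpos
            have : 0 ≤ q.1 := not_lt.1 ht
            have hp : (0 : ℝ) < (n : ℝ) + 1 := by positivity
            nlinarith
          simp [this]
      · have h0 : Gf Ab u φ q = 0 := by
          unfold Gf
          simp [pd_eq, dw_zero_off _ hq, image_eq_zero_of_notMem_tsupport hq]
        have : (Qc0 R).indicator (Gf Ab u φ) q = 0 := by
          by_cases hc : q ∈ Qc0 R
          · rw [indicator_of_mem hc, h0]
          · rw [indicator_of_notMem hc]
        simp [h0, this]
  simp only [hn] at hlim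
  rw [integral_indicator hQm] at hlim
  exact (tendsto_nhds_unique hlim tendsto_const_nhds)

lemma intQ {R : ℝ} {f : ℝ × Ed d → ℝ} (hf : Continuous f) : IntegrableOn f (Qc0 R) := by
  have hK : IsCompact (Icc (0 - R ^ 2) 0 ×ˢ closedBall (0 : Ed d) R) :=
    isCompact_Icc.prod (isCompact_closedBall _ _)
  exact (hf.continuousOn.integrableOn_compact hK).mono_set
    (Set.prod_mono Ioo_subset_Icc_self ball_subset_closedBall)

lemma ftcQ {R : ℝ} {h : ℝ × Ed d → ℝ} (hh : ContDiff ℝ (⊤ : ℕ∞) h)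
    (hsub : tsupport h ⊆ Ioi (-R ^ 2) ×ˢ ball 0 R) (h0 : ∀ q, 0 ≤ h q) :
    0 ≤ ∫ q in Qc0 R, pt h q := by
  have hi : IntegrableOn (pt h) (Qc0 R) := intQ (smooth_pt hh).continuous
  unfold Qc0 Qc at hi ⊢
  rw [Measure.volume_eq_prod] at hi ⊢
  rw [← setIntegral_prod_swap, setIntegral_prod (fun z : Ed d × ℝ => pt h z.swap) hi.swap]
  refine integral_nonneg fun x => ?_
  simp only [Prod.swap_prod_mk, Pi.zero_apply]
  have hR : (0 : ℝ) - R ^ 2 ≤ 0 := by nlinarith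
  rw [← integral_Ioc_eq_integral_Ioo, ← intervalIntegral.integral_of_le hR]
  have hd : ∀ t : ℝ, HasDerivAt (fun t => h (t, x)) (pt h (t, x)) t := by
    intro t
    have h1 : HasFDerivAt h (fderiv ℝ h (t, x)) (t, x) :=
      ((hh.differentiable (by simp)) (t, x)).hasFDerivAt
    have h2 : HasDerivAt (fun t : ℝ => (t, x)) ((1 : ℝ), (0 : Ed d)) t :=
      (hasDerivAt_id t).prodMk (hasDerivAt_const t x)
    exact h1.comp_hasDerivAt t h2
  have hc : Continuous (fun t : ℝ => pt h (t, x)) :=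
    (smooth_pt hh).continuous.comp (by fun_prop)
  rw [intervalIntegral.integral_eq_sub_of_hasDerivAt (fun t _ => hd t)
    (hc.intervalIntegrable _ _)]
  have : h (0 - R ^ 2, x) = 0 := by
    apply image_eq_zero_of_notMem_tsupport
    intro hc
    have : -R ^ 2 < 0 - R ^ 2 := (hsub hc).1
    linarith
  rw [this]
  linarith [h0 (0, x)]

end weak

section est
variable {d m : ℕ}

/-- Cutoff functions adapted to `Q_r ⊂ Q_R`. -/
structure Cut (r R K : ℝ) (ζ : ℝ × Ed d → ℝ) : Prop where
  smooth : ContDiff ℝ (⊤ : ℕ∞) ζ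
  cs : HasCompactSupport ζ
  sub : tsupport ζ ⊆ Ioi (-R ^ 2) ×ˢ ball 0 R
  nonneg : ∀ q, 0 ≤ ζ q
  le_one : ∀ q, ζ q ≤ 1
  one : ∀ q ∈ Qc0 r, ζ q = 1
  bt : ∀ q, |pt ζ q| ≤ K
  bx : ∀ α q, |pd α ζ q| ≤ K

lemma exists_cut {r R : ℝ} (hr : 0 < r) (hrR : r < R) :
    ∃ K : ℝ, 0 ≤ K ∧ ∃ ζ : ℝ × Ed d → ℝ, Cut r R K ζ := by
  obtain ⟨ρ, h1, h2⟩ := exists_between hrR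
  have h3 : r ^ 2 < ρ ^ 2 := by gcongr
  have h4 : ρ ^ 2 < R ^ 2 := by gcongr; linarith
  let f : ContDiffBump (0 : ℝ) := ⟨r ^ 2, ρ ^ 2, by positivity, h3⟩
  let g : ContDiffBump (0 : Ed d) := ⟨r, ρ, hr, h1⟩
  let ζ : ℝ × Ed d → ℝ := fun q => f q.1 * g q.2
  have hsm : ContDiff ℝ (⊤ : ℕ∞) ζ :=
    (f.contDiff.comp contDiff_fst).mul (g.contDiff.comp contDiff_snd)
  have hts : tsupport ζ ⊆ closedBall 0 (ρ ^ 2) ×ˢ closedBall 0 ρ := by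
    refine closure_minimal ?_ (isClosed_closedBall.prod isClosed_closedBall)
    intro q hq
    have hq' : f q.1 * g q.2 ≠ 0 := hq
    have ha : q.1 ∈ support f := left_ne_zero_of_mul hq'
    have hb : q.2 ∈ support g := right_ne_zero_of_mul hq'
    rw [f.support_eq] at ha
    rw [g.support_eq] at hb
    exact ⟨ball_subset_closedBall ha, ball_subset_closedBall hb⟩
  have hcs : HasCompactSupport ζ :=
    ((isCompact_closedBall _ _).prod (isCompact_closedBall _ _)).of_isClosed_subset
      (isClosed_tsupport _) hts
  have hb : ∀ w, ∃ C, ∀ q, ‖dw w ζ q‖ ≤ C := fun w =>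
    (hcs_dw w hcs).exists_bound_of_continuous (smooth_dw w hsm).continuous
  choose C hC using hb
  refine ⟨|C (1, 0)| + ∑ α : Fin d, |C (0, EuclideanSpace.single α 1)|, by positivity, ζ, hsm, hcs,
    ?_, ?_, ?_, ?_, ?_, ?_⟩
  · intro q hq
    have := hts hq
    refine ⟨?_, closedBall_subset_ball h2 this.2⟩
    have h5 : |q.1| ≤ ρ ^ 2 := by simpa using this.1
    have := (abs_le.1 h5).1
    simp only [mem_Ioi]
    linarith
  · intro q; exact mul_nonneg f.nonneg g.nonneg
  · intro q; exact mul_le_one₀ f.le_one g.nonneg g.le_one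
  · intro q hq
    have e1 : f q.1 = 1 := by
      apply f.one_of_mem_closedBall
      have := hq.1
      simp only [mem_closedBall, Real.dist_eq, sub_zero]
      rw [abs_le]
      constructor
      · have := this.1; simp only [f]; linarith
      · have := this.2; have := sq_nonneg r; simp only [f]; linarith
    have e2 : g q.2 = 1 := g.one_of_mem_closedBall (ball_subset_closedBall hq.2)
    simp [ζ, e1, e2]
  · intro q
    have h5 := (hC (1, 0) q).trans (le_abs_self _)
    have h6 : 0 ≤ ∑ α : Fin d, |C (0, EuclideanSpace.single α 1)| := by positivity
    rw [Real.norm_eq_abs] at h5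
    rw [pt_eq]; linarith
  · intro α q
    have h5 := (hC (0, EuclideanSpace.single α 1) q).trans (le_abs_self _)
    have h6 := Finset.single_le_sum (f := fun α : Fin d => |C (0, EuclideanSpace.single α 1)|)
      (fun i _ => abs_nonneg _) (Finset.mem_univ α)
    rw [Real.norm_eq_abs] at h5
    rw [pd_eq]
    have := abs_nonneg (C (1, 0))
    linarith

lemma young {ε : ℝ} (hε : 0 < ε) (M x y : ℝ) : M * x * y ≤ ε * x ^ 2 + M ^ 2 / (4 * ε) * y ^ 2 := by
  have : ε * x ^ 2 + M ^ 2 / (4 * ε) * y ^ 2 - M * x * y = ε * (x - M / (2 * ε) * y) ^ 2 := by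
    field_simp; ring
  nlinarith [mul_nonneg hε.le (sq_nonneg (x - M / (2 * ε) * y))]

lemma term_bound {δ : ℝ} {a : CLM m} (ha : ‖a‖ ≤ δ⁻¹) (x y : Em m) :
    |⟪a x, y⟫| ≤ δ⁻¹ * ‖x‖ * ‖y‖ :=
  calc |⟪a x, y⟫| ≤ ‖a x‖ * ‖y‖ := abs_real_inner_le_norm _ _
    _ ≤ (‖a‖ * ‖x‖) * ‖y‖ := by gcongr; exact a.le_opNorm _
    _ ≤ _ := by gcongr

/-- pointwise inequality behind Caccioppoli -/
lemma pw1 [NeZero d] {δ : ℝ} (hδ : 0 < δ) {K : ℝ} (hK : 0 ≤ K) {a : Fin d → Fin d → CLM m}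
    (ha : EllipticPt δ a)
    (ξ : Fin d → Em m) (w wt : Em m) (z zt : ℝ) (zx : Fin d → ℝ) (hz : 0 ≤ z) (hz1 : z ≤ 1)
    (hzt : |zt| ≤ K) (hzx : ∀ α, |zx α| ≤ K) :
    δ / 2 * (z ^ 4 * ∑ α, ‖ξ α‖ ^ 2) ≤
      (⟪wt, z ^ 4 • w⟫ + ∑ α, ∑ β, ⟪a α β (ξ β), z ^ 4 • ξ α + (4 * z ^ 3 * zx α) • w⟫)
      - (z ^ 4 * ⟪wt, w⟫ + 2 * z ^ 3 * zt * ‖w‖ ^ 2)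
      + (2 * K + (d : ℝ) ^ 2 * ((4 * K * δ⁻¹) ^ 2 / (4 * (δ / (2 * d))))) * (z ^ 2 * ‖w‖ ^ 2) := by
  have hd : (0 : ℝ) < d := by exact_mod_cast Nat.pos_of_ne_zero (NeZero.ne d)
  have hε : 0 < δ / (2 * d) := by positivity
  have hell := ha.2 ξ
  have hX : ∀ α β, -(δ / (2 * d) * (z ^ 4 * ‖ξ β‖ ^ 2)
      + (4 * K * δ⁻¹) ^ 2 / (4 * (δ / (2 * d))) * (z ^ 2 * ‖w‖ ^ 2))
      ≤ (4 * z ^ 3 * zx α) * ⟪a α β (ξ β), w⟫ := by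
    intro α β
    have h1 : |(4 * z ^ 3 * zx α) * ⟪a α β (ξ β), w⟫| ≤
        (4 * z ^ 3 * K) * (δ⁻¹ * ‖ξ β‖ * ‖w‖) := by
      rw [abs_mul, abs_mul, abs_of_nonneg (by positivity : 0 ≤ 4 * z ^ 3)]
      have := hzx α
      have := term_bound (ha.1 α β) (ξ β) w
      gcongr
    have h2 := young hε (4 * K * δ⁻¹) (z ^ 2 * ‖ξ β‖) (z * ‖w‖)
    have h3 := (abs_le.1 h1).1
    calc _ = -(δ / (2 * d) * (z ^ 2 * ‖ξ β‖) ^ 2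
          + (4 * K * δ⁻¹) ^ 2 / (4 * (δ / (2 * d))) * (z * ‖w‖) ^ 2) := by ring
      _ ≤ -(4 * K * δ⁻¹ * (z ^ 2 * ‖ξ β‖) * (z * ‖w‖)) := neg_le_neg h2
      _ = -((4 * z ^ 3 * K) * (δ⁻¹ * ‖ξ β‖ * ‖w‖)) := by ring
      _ ≤ _ := h3
  have hS := Finset.sum_le_sum fun α (_ : α ∈ Finset.univ) =>
    Finset.sum_le_sum fun β (_ : β ∈ Finset.univ) => hX α β
  have e1 : ∑ α : Fin d, ∑ β : Fin d, -(δ / (2 * d) * (z ^ 4 * ‖ξ β‖ ^ 2)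
      + (4 * K * δ⁻¹) ^ 2 / (4 * (δ / (2 * d))) * (z ^ 2 * ‖w‖ ^ 2))
      = -(δ / 2 * (z ^ 4 * ∑ α, ‖ξ α‖ ^ 2)
      + (d : ℝ) ^ 2 * ((4 * K * δ⁻¹) ^ 2 / (4 * (δ / (2 * d)))) * (z ^ 2 * ‖w‖ ^ 2)) := by
    simp only [Finset.sum_neg_distrib, Finset.sum_add_distrib, ← Finset.mul_sum, Finset.sum_const,
      Finset.card_univ, Fintype.card_fin, nsmul_eq_mul]
    field_simp
  rw [e1] at hS
  have e2 : ∑ α, ∑ β, ⟪a α β (ξ β), z ^ 4 • ξ α + (4 * z ^ 3 * zx α) • w⟫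
      = z ^ 4 * (∑ α, ∑ β, ⟪ξ α, a α β (ξ β)⟫)
        + ∑ α, ∑ β, (4 * z ^ 3 * zx α) * ⟪a α β (ξ β), w⟫ := by
    simp only [inner_add_right, inner_smul_right, Finset.sum_add_distrib, Finset.mul_sum]
    congr 1
    refine Finset.sum_congr rfl fun α _ => Finset.sum_congr rfl fun β _ => ?_
    rw [real_inner_comm]
  rw [e2, inner_smul_right]
  have h5 : z ^ 4 * (δ * ∑ α, ‖ξ α‖ ^ 2) ≤ z ^ 4 * (∑ α, ∑ β, ⟪ξ α, a α β (ξ β)⟫) := by gcongr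
  have h6 : 2 * z ^ 3 * zt * ‖w‖ ^ 2 ≤ 2 * K * (z ^ 2 * ‖w‖ ^ 2) := by
    have : z ^ 3 * zt ≤ z ^ 2 * K := by
      have h7 : z ^ 3 ≤ z ^ 2 := pow_le_pow_of_le_one hz hz1 (by norm_num)
      have h8 := (abs_le.1 hzt).2
      calc z ^ 3 * zt ≤ z ^ 3 * K := by gcongr
        _ ≤ _ := by gcongr
    nlinarith [sq_nonneg ‖w‖]
  linarith

/-- pointwise inequality behind the time derivative estimate -/
lemma pw2 {δ : ℝ} {K : ℝ} (hK : 0 ≤ K) {ε ε' : ℝ} (hε : 0 < ε)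
    (hε' : 0 < ε') {a : Fin d → Fin d → CLM m} (ha : EllipticPt δ a)
    (ξ η : Fin d → Em m) (w : Em m) (z : ℝ) (zx : Fin d → ℝ) (hz : 0 ≤ z)
    (hzx : ∀ α, |zx α| ≤ K) :
    z ^ 2 * ‖w‖ ^ 2 ≤
      (⟪w, z ^ 2 • w⟫ + ∑ α, ∑ β, ⟪a α β (ξ β), z ^ 2 • η α + (2 * z * zx α) • w⟫)
      + d * ε * (z ^ 4 * ∑ α, ‖η α‖ ^ 2) + (d : ℝ) ^ 2 * ε' * (z ^ 2 * ‖w‖ ^ 2)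
      + d * ((δ⁻¹) ^ 2 / (4 * ε) + (2 * K * δ⁻¹) ^ 2 / (4 * ε')) * ∑ α, ‖ξ α‖ ^ 2 := by
  have hX : ∀ α β, -(ε * (z ^ 4 * ‖η α‖ ^ 2) + ε' * (z ^ 2 * ‖w‖ ^ 2)
      + ((δ⁻¹) ^ 2 / (4 * ε) + (2 * K * δ⁻¹) ^ 2 / (4 * ε')) * ‖ξ β‖ ^ 2)
      ≤ ⟪a α β (ξ β), z ^ 2 • η α + (2 * z * zx α) • w⟫ := by
    intro α β
    have hδ : 0 ≤ δ⁻¹ := (norm_nonneg _).trans (ha.1 α β)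
    have h1 : |(2 * z * zx α) * ⟪a α β (ξ β), w⟫| ≤
        (2 * z * K) * (δ⁻¹ * ‖ξ β‖ * ‖w‖) := by
      rw [abs_mul, abs_mul, abs_of_nonneg (by positivity : 0 ≤ 2 * z)]
      have := hzx α
      have := term_bound (ha.1 α β) (ξ β) w
      gcongr
    have h2 := young hε' (2 * K * δ⁻¹) (z * ‖w‖) ‖ξ β‖
    have h3 := (abs_le.1 h1).1
    have h4 : |z ^ 2 * ⟪a α β (ξ β), η α⟫| ≤ z ^ 2 * (δ⁻¹ * ‖ξ β‖ * ‖η α‖) := by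
      rw [abs_mul, abs_of_nonneg (by positivity : 0 ≤ z ^ 2)]
      have := term_bound (ha.1 α β) (ξ β) (η α)
      gcongr
    have h5 := (abs_le.1 h4).1
    have h6 := young hε (δ⁻¹) (z ^ 2 * ‖η α‖) ‖ξ β‖
    rw [inner_add_right, inner_smul_right, inner_smul_right]
    linarith
  have hS := Finset.sum_le_sum fun α (_ : α ∈ Finset.univ) =>
    Finset.sum_le_sum fun β (_ : β ∈ Finset.univ) => hX α β
  simp only [Finset.sum_neg_distrib, Finset.sum_add_distrib, ← Finset.mul_sum, Finset.sum_const,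
      Finset.card_univ, Fintype.card_fin, nsmul_eq_mul] at hS
  have e : ⟪w, z ^ 2 • w⟫ = z ^ 2 * ‖w‖ ^ 2 := by
    rw [inner_smul_right, real_inner_self_eq_norm_sq]
  rw [e]
  linarith

lemma dw_pow {ζ : ℝ × Ed d → ℝ} (h : ContDiff ℝ (⊤ : ℕ∞) ζ) (w q : ℝ × Ed d) (n : ℕ) :
    dw w (fun q => ζ q ^ n) q = n * ζ q ^ (n - 1) * dw w ζ q := by
  unfold dw
  rw [fderiv_fun_pow n ((h.differentiable (by simp)) q)]
  simp

lemma dw_normSq {u : ℝ × Ed d → Em m} (h : ContDiff ℝ (⊤ : ℕ∞) u) (w q : ℝ × Ed d) :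
    dw w (fun q => ‖u q‖ ^ 2) q = 2 * ⟪dw w u q, u q⟫ := by
  unfold dw
  have := ((h.differentiable (by simp)) q).hasFDerivAt.norm_sq
  rw [this.fderiv]
  simp [real_inner_comm]

lemma cont_gradSq {u : ℝ × Ed d → Em m} (h : ContDiff ℝ (⊤ : ℕ∞) u) : Continuous (gradSq u) := by
  unfold gradSq
  exact continuous_finsetSum _ fun α _ => ((smooth_pd α h).continuous.norm.pow 2)

lemma cut_test {ζ : ℝ × Ed d → ℝ} {F : Type*}
    [NormedAddCommGroup F] [NormedSpace ℝ F] (w : ℝ × Ed d → F) {n : ℕ} (hn : n ≠ 0) :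
    tsupport (fun q => ζ q ^ n • w q) ⊆ tsupport ζ := by
  refine closure_mono fun q hq => ?_
  intro h0
  apply hq
  have h0' : ζ q = 0 := h0
  simp [h0', hn]

lemma cacc [NeZero d] {δ : ℝ} (hδ : 0 < δ) {K : ℝ} (hK : 0 ≤ K) : ∃ C : ℝ, 0 ≤ C ∧
    ∀ (r R : ℝ) (ζ : ℝ × Ed d → ℝ), Cut r R K ζ →
    ∀ (Ab : Fin d → Fin d → ℝ → CLM m), CoeffsOne δ Ab →
    ∀ w : ℝ × Ed d → Em m, Sol Ab R w →
      ∫ q in Qc0 R, ζ q ^ 4 * gradSq w q ≤ C * ∫ q in Qc0 R, ζ q ^ 2 * ‖w q‖ ^ 2 := by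
  set C' : ℝ := 2 * K + (d : ℝ) ^ 2 * ((4 * K * δ⁻¹) ^ 2 / (4 * (δ / (2 * d)))) with hC'
  refine ⟨(δ / 2)⁻¹ * C', by positivity, ?_⟩
  intro r R ζ hζ Ab hA w hw
  have hws := hw.1
  have hφ : ContDiff ℝ (⊤ : ℕ∞) (fun q => ζ q ^ 4 • w q) := (hζ.smooth.pow 4).smul hws
  have hts := cut_test (ζ := ζ) w (n := 4) (by norm_num)
  have hcs : HasCompactSupport (fun q => ζ q ^ 4 • w q) :=
    hζ.cs.of_isClosed_subset (isClosed_tsupport _) hts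
  have hG0 := weakQ hA hw hφ hcs (hts.trans hζ.sub)
  have hGi := (int_G hA hws hφ hcs).integrableOn (s := Qc0 R)
  have hh : ContDiff ℝ (⊤ : ℕ∞) (fun q => ζ q ^ 4 • ‖w q‖ ^ 2) :=
    (hζ.smooth.pow 4).smul (hws.norm_sq ℝ)
  have hT0 := ftcQ (R := R) hh
    ((cut_test (ζ := ζ) (fun q => ‖w q‖ ^ 2) (n := 4) (by norm_num)).trans hζ.sub)
    (fun q => by have := hζ.nonneg q; simp only [smul_eq_mul]; positivity)
  have hTi : IntegrableOn (pt (fun q => ζ q ^ 4 • ‖w q‖ ^ 2)) (Qc0 R) :=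
    intQ (smooth_pt hh).continuous
  have hζc := hζ.smooth.continuous
  have hwc := hws.continuous
  have hLi : IntegrableOn (fun q => ζ q ^ 4 * gradSq w q) (Qc0 R) :=
    intQ ((hζc.pow 4).mul (cont_gradSq hws))
  have hRi : IntegrableOn (fun q => ζ q ^ 2 * ‖w q‖ ^ 2) (Qc0 R) :=
    intQ (by fun_prop)
  have hpw : ∀ q, δ / 2 * (ζ q ^ 4 * gradSq w q) ≤ Gf Ab w (fun q => ζ q ^ 4 • w q) q
      - 1 / 2 * pt (fun q => ζ q ^ 4 • ‖w q‖ ^ 2) q + C' * (ζ q ^ 2 * ‖w q‖ ^ 2) := by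
    intro q
    have h1 := pw1 hδ hK (hA.2 (q.2 0)) (fun α => pd α w q) (w q) (pt w q) (ζ q) (pt ζ q)
      (fun α => pd α ζ q) (hζ.nonneg q) (hζ.le_one q) (hζ.bt q) (fun α => hζ.bx α q)
    have e1 : ∀ α, pd α (fun q => ζ q ^ 4 • w q) q
        = ζ q ^ 4 • pd α w q + (4 * ζ q ^ 3 * pd α ζ q) • w q := by
      intro α
      rw [pd_eq, dw_smul _ _ (hζ.smooth.pow 4) hws, dw_pow hζ.smooth]
      simp [pd_eq]
    have e2 : pt (fun q => ζ q ^ 4 • ‖w q‖ ^ 2) q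
        = 2 * (ζ q ^ 4 * ⟪pt w q, w q⟫ + 2 * ζ q ^ 3 * pt ζ q * ‖w q‖ ^ 2) := by
      rw [pt_eq, dw_smul _ _ (hζ.smooth.pow 4) (hws.norm_sq ℝ), dw_pow hζ.smooth, dw_normSq hws]
      simp only [pt_eq, smul_eq_mul]
      push_cast
      ring
    rw [e2]
    unfold Gf gradSq
    simp only [e1]
    rw [← hC'] at h1
    linarith
  have i1 : IntegrableOn (fun q => Gf Ab w (fun q => ζ q ^ 4 • w q) q
      - 1 / 2 * pt (fun q => ζ q ^ 4 • ‖w q‖ ^ 2) q) (Qc0 R) := hGi.sub (hTi.const_mul (1 / 2))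
  have hineq := setIntegral_mono (hLi.const_mul (δ / 2)) (i1.add (hRi.const_mul C')) hpw
  simp only [Pi.add_apply] at hineq
  rw [integral_add i1 (hRi.const_mul C'),
    integral_sub hGi (hTi.const_mul (1 / 2)), integral_const_mul, integral_const_mul,
    integral_const_mul, hG0] at hineq
  rw [mul_assoc, ← div_eq_inv_mul, le_div_iff₀ (by positivity)]
  linarith

lemma timeEst [NeZero d] {δ : ℝ} (hδ : 0 < δ) {K : ℝ} (hK : 0 ≤ K) : ∃ C : ℝ, 0 ≤ C ∧
    ∀ (r R : ℝ) (ζ : ℝ × Ed d → ℝ), Cut r R K ζ →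
    ∀ (Ab : Fin d → Fin d → ℝ → CLM m), CoeffsOne δ Ab →
    ∀ v : ℝ × Ed d → Em m, Sol Ab R v →
      ∫ q in Qc0 R, ζ q ^ 2 * ‖pt v q‖ ^ 2 ≤ C * ∫ q in Qc0 R, gradSq v q := by
  obtain ⟨C1, hC1, hcacc⟩ := cacc (d := d) (m := m) hδ hK
  have hd : (0 : ℝ) < d := by exact_mod_cast Nat.pos_of_ne_zero (NeZero.ne d)
  set ε : ℝ := 1 / (4 * d * (C1 + 1)) with hε
  set ε' : ℝ := 1 / (4 * (d : ℝ) ^ 2) with hε'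
  have hεp : 0 < ε := by positivity
  have hεp' : 0 < ε' := by positivity
  set C2 : ℝ := d * ((δ⁻¹) ^ 2 / (4 * ε) + (2 * K * δ⁻¹) ^ 2 / (4 * ε')) with hC2
  refine ⟨2 * C2, by positivity, ?_⟩
  intro r R ζ hζ Ab hA v hv
  have hvs := hv.1
  have hws : ContDiff ℝ (⊤ : ℕ∞) (pt v) := smooth_pt hvs
  have hw : Sol Ab R (pt v) := Sol.dw hA hv (w := (1, 0)) (by simp)
  have hφ : ContDiff ℝ (⊤ : ℕ∞) (fun q => ζ q ^ 2 • pt v q) := (hζ.smooth.pow 2).smul hws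
  have hts := cut_test (ζ := ζ) (pt v) (n := 2) (by norm_num)
  have hcs : HasCompactSupport (fun q => ζ q ^ 2 • pt v q) :=
    hζ.cs.of_isClosed_subset (isClosed_tsupport _) hts
  have hG0 := weakQ hA hv hφ hcs (hts.trans hζ.sub)
  have hGi := (int_G hA hvs hφ hcs).integrableOn (s := Qc0 R)
  have hζc := hζ.smooth.continuous
  have hwc := hws.continuous
  have hHi : IntegrableOn (fun q => ζ q ^ 4 * gradSq (pt v) q) (Qc0 R) :=
    intQ ((hζc.pow 4).mul (cont_gradSq hws))
  have hLi : IntegrableOn (fun q => ζ q ^ 2 * ‖pt v q‖ ^ 2) (Qc0 R) :=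
    intQ (by fun_prop)
  have hRi : IntegrableOn (gradSq v) (Qc0 R) := intQ (cont_gradSq hvs)
  have hpw : ∀ q, ζ q ^ 2 * ‖pt v q‖ ^ 2 ≤ Gf Ab v (fun q => ζ q ^ 2 • pt v q) q
      + d * ε * (ζ q ^ 4 * gradSq (pt v) q) + (d : ℝ) ^ 2 * ε' * (ζ q ^ 2 * ‖pt v q‖ ^ 2)
      + C2 * gradSq v q := by
    intro q
    have h1 := pw2 hK hεp hεp' (hA.2 (q.2 0)) (fun α => pd α v q) (fun α => pd α (pt v) q)
      (pt v q) (ζ q) (fun α => pd α ζ q) (hζ.nonneg q) (fun α => hζ.bx α q)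
    have e1 : ∀ α, pd α (fun q => ζ q ^ 2 • pt v q) q
        = ζ q ^ 2 • pd α (pt v) q + (2 * ζ q * pd α ζ q) • pt v q := by
      intro α
      rw [pd_eq, dw_smul _ _ (hζ.smooth.pow 2) hws, dw_pow hζ.smooth]
      simp [pd_eq]
    unfold Gf gradSq
    simp only [e1]
    exact h1
  have i1 : IntegrableOn (fun q => Gf Ab v (fun q => ζ q ^ 2 • pt v q) q
      + d * ε * (ζ q ^ 4 * gradSq (pt v) q)) (Qc0 R) := hGi.add (hHi.const_mul (d * ε))
  have i2 : IntegrableOn (fun q => Gf Ab v (fun q => ζ q ^ 2 • pt v q) q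
      + d * ε * (ζ q ^ 4 * gradSq (pt v) q)
      + (d : ℝ) ^ 2 * ε' * (ζ q ^ 2 * ‖pt v q‖ ^ 2)) (Qc0 R) :=
    i1.add (hLi.const_mul ((d : ℝ) ^ 2 * ε'))
  have hineq := setIntegral_mono hLi (i2.add (hRi.const_mul C2)) hpw
  simp only [Pi.add_apply] at hineq
  rw [integral_add i2 (hRi.const_mul C2),
    integral_add i1 (hLi.const_mul ((d : ℝ) ^ 2 * ε')),
    integral_add hGi (hHi.const_mul (d * ε)), integral_const_mul, integral_const_mul,
    integral_const_mul, hG0] at hineq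
  have hc := hcacc r R ζ hζ Ab hA (pt v) hw
  set I := ∫ q in Qc0 R, ζ q ^ 2 * ‖pt v q‖ ^ 2 with hI
  have hI0 : 0 ≤ I := integral_nonneg fun q => by positivity
  have h1 : (d : ℝ) ^ 2 * ε' = 1 / 4 := by rw [hε']; field_simp
  have h2 : d * ε * ∫ q in Qc0 R, ζ q ^ 4 * gradSq (pt v) q ≤ 1 / 4 * I := by
    have h3 : d * ε * C1 ≤ 1 / 4 := by
      have : d * ε * C1 = C1 / (C1 + 1) / 4 := by rw [hε]; field_simp
      rw [this]
      have : C1 / (C1 + 1) ≤ 1 := by rw [div_le_one (by positivity)]; linarith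
      linarith
    calc _ ≤ d * ε * (C1 * I) := by gcongr
      _ = d * ε * C1 * I := by ring
      _ ≤ _ := by gcongr
  rw [h1] at hineq
  linarith

end est

section fin
variable {d m : ℕ}

/-- One admissible differentiation. -/
def Step [NeZero d] (v w : ℝ × Ed d → Em m) : Prop :=
  w = pt v ∨ ∃ k : Fin d, k ≠ 0 ∧ w = pd k v

/-- `n` admissible differentiations. -/
inductive Der [NeZero d] (u : ℝ × Ed d → Em m) : ℕ → (ℝ × Ed d → Em m) → Prop
  | zero : Der u 0 u
  | succ {n : ℕ} {v w : ℝ × Ed d → Em m} : Der u n v → Step v w → Der u (n + 1) w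

lemma cut_le {r R K : ℝ} (hr : 0 < r) (hrR : r < R) {ζ : ℝ × Ed d → ℝ} (hζ : Cut r R K ζ)
    {f : ℝ × Ed d → ℝ} (hf : Continuous f) (h0 : ∀ q, 0 ≤ f q) (n : ℕ) :
    ∫ q in Qc0 r, f q ≤ ∫ q in Qc0 R, ζ q ^ n * f q := by
  have hQm : MeasurableSet (Qc0 (d := d) r) := measurableSet_Ioo.prod measurableSet_ball
  have hsub : Qc0 (d := d) r ⊆ Qc0 R := by
    have : r ^ 2 ≤ R ^ 2 := by gcongr
    exact Set.prod_mono (Ioo_subset_Ioo (by linarith) le_rfl) (ball_subset_ball hrR.le)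
  have e : ∫ q in Qc0 r, f q = ∫ q in Qc0 r, ζ q ^ n * f q :=
    setIntegral_congr_fun hQm fun q hq => by simp [hζ.one q hq]
  rw [e]
  refine setIntegral_mono_set (intQ ((hζ.smooth.continuous.pow n).mul hf))
    (Filter.Eventually.of_forall fun q => ?_) (Filter.Eventually.of_forall hsub)
  exact mul_nonneg (pow_nonneg (hζ.nonneg q) n) (h0 q)

lemma gradSq_nonneg (u : ℝ × Ed d → Em m) (q : ℝ × Ed d) : 0 ≤ gradSq u q := by
  unfold gradSq; positivity

lemma le_gradSq (u : ℝ × Ed d → Em m) (q : ℝ × Ed d) (k : Fin d) :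
    ‖pd k u q‖ ^ 2 ≤ gradSq u q :=
  Finset.single_le_sum (f := fun α => ‖pd α u q‖ ^ 2) (fun i _ => by positivity)
    (Finset.mem_univ k)

lemma step_est (d m : ℕ) [NeZero d] {δ : ℝ} (hδ : 0 < δ) {r R : ℝ} (hr : 0 < r) (hrR : r < R) :
    ∃ N : ℝ, 0 ≤ N ∧ ∀ (Ab : Fin d → Fin d → ℝ → CLM m), CoeffsOne δ Ab →
    ∀ v w : ℝ × Ed d → Em m, Sol Ab R v → Step v w →
      Sol Ab R w ∧ ∫ q in Qc0 r, ‖w q‖ ^ 2 ≤ N * ∫ q in Qc0 R, gradSq v q ∧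
      ∫ q in Qc0 r, gradSq w q ≤ N * ∫ q in Qc0 R, gradSq v q := by
  obtain ⟨K, hK, ζ, hζ⟩ := exists_cut (d := d) hr hrR
  obtain ⟨C1, hC1, h1⟩ := cacc (d := d) (m := m) hδ hK
  obtain ⟨C2, hC2, h2⟩ := timeEst (d := d) (m := m) hδ hK
  refine ⟨(1 + C1) * (1 + C2), by positivity, ?_⟩
  intro Ab hA v w hv hs
  have hw : Sol Ab R w := by
    rcases hs with rfl | ⟨k, hk, rfl⟩
    · exact Sol.dw hA hv (w := (1, 0)) (by simp)
    · exact Sol.dw hA hv (w := (0, EuclideanSpace.single k 1)) (by simp [hk.symm])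
  set I := ∫ q in Qc0 R, gradSq v q with hI
  have hI0 : 0 ≤ I := integral_nonneg fun q => gradSq_nonneg v q
  have hwc := hw.1.continuous
  have hζc := hζ.smooth.continuous
  have key : ∫ q in Qc0 R, ζ q ^ 2 * ‖w q‖ ^ 2 ≤ (1 + C2) * I := by
    rcases hs with rfl | ⟨k, hk, rfl⟩
    · have := h2 r R ζ hζ Ab hA v hv
      linarith
    · have : ∫ q in Qc0 R, ζ q ^ 2 * ‖pd k v q‖ ^ 2 ≤ I := by
        refine setIntegral_mono (intQ (by fun_prop)) (intQ (cont_gradSq hv.1)) fun q => ?_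
        have h3 : ζ q ^ 2 ≤ 1 := pow_le_one₀ (hζ.nonneg q) (hζ.le_one q)
        have h4 := le_gradSq v q k
        have h5 := sq_nonneg ‖pd k v q‖
        change ζ q ^ 2 * ‖pd k v q‖ ^ 2 ≤ gradSq v q
        nlinarith
      nlinarith [mul_nonneg hC2 hI0]
  have ha := cut_le hr hrR hζ (f := fun q => ‖w q‖ ^ 2) (by fun_prop) (fun q => by positivity) 2
  have hb := cut_le hr hrR hζ (cont_gradSq hw.1) (gradSq_nonneg w) 4
  have hc := h1 r R ζ hζ Ab hA w hw
  have hCI : 0 ≤ (1 + C2) * I := by positivity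
  refine ⟨hw, ?_, ?_⟩
  · calc _ ≤ (1 + C2) * I := ha.trans key
      _ ≤ (1 + C1) * (1 + C2) * I := by nlinarith
  · calc _ ≤ C1 * ∫ q in Qc0 R, ζ q ^ 2 * ‖w q‖ ^ 2 := hb.trans hc
      _ ≤ C1 * ((1 + C2) * I) := by gcongr
      _ ≤ _ := by nlinarith

lemma der_est (d m : ℕ) [NeZero d] {δ : ℝ} (hδ : 0 < δ) (n : ℕ) :
    ∀ {r R : ℝ}, 0 < r → r < R → ∃ N : ℝ, 0 ≤ N ∧
    ∀ (Ab : Fin d → Fin d → ℝ → CLM m), CoeffsOne δ Ab →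
    ∀ u v : ℝ × Ed d → Em m, Sol Ab R u → Der u n v →
      Sol Ab R v ∧ ∫ q in Qc0 r, gradSq v q ≤ N * ∫ q in Qc0 R, gradSq u q := by
  induction n with
  | zero =>
    intro r R hr hrR
    refine ⟨1, zero_le_one, fun Ab hA u v hu hD => ?_⟩
    cases hD
    refine ⟨hu, ?_⟩
    rw [one_mul]
    obtain ⟨K, hK, ζ, hζ⟩ := exists_cut (d := d) hr hrR
    have := cut_le hr hrR hζ (cont_gradSq hu.1) (gradSq_nonneg u) 1
    refine this.trans (setIntegral_mono
      (intQ ((hζ.smooth.continuous.pow 1).mul (cont_gradSq hu.1))) (intQ (cont_gradSq hu.1))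
      fun q => ?_)
    have h1 := hζ.le_one q
    have h2 := gradSq_nonneg u q
    change ζ q ^ 1 * gradSq u q ≤ gradSq u q
    nlinarith
  | succ n ih =>
    intro r R hr hrR
    obtain ⟨ρ, h1, h2⟩ := exists_between hrR
    obtain ⟨N1, hN1, H1⟩ := ih (hr.trans h1) h2
    obtain ⟨N2, hN2, H2⟩ := step_est d m hδ hr h1
    obtain ⟨N3, hN3, H3⟩ := step_est d m hδ hr hrR
    refine ⟨N2 * N1, by positivity, fun Ab hA u v hu hD => ?_⟩
    cases hD with
    | succ hD' hs =>
      obtain ⟨hv, e1⟩ := H1 Ab hA u _ hu hD'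
      obtain ⟨-, -, e2⟩ := H2 Ab hA _ _ (hv.mono (hr.trans h1) h2.le) hs
      refine ⟨(H3 Ab hA _ _ hv hs).1, e2.trans ?_⟩
      rw [mul_assoc]
      gcongr

lemma der_foldr [NeZero d] (u : ℝ × Ed d → Em m) (l : List (Fin d)) (hl : ∀ β ∈ l, β ≠ 0) :
    Der u l.length (l.foldr pd u) := by
  induction l with
  | nil => exact Der.zero
  | cons a l ih =>
    exact Der.succ (ih fun β hβ => hl β (List.mem_cons_of_mem _ hβ))
      (Or.inr ⟨a, hl a List.mem_cons_self, rfl⟩)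

lemma der_iter [NeZero d] (u v : ℝ × Ed d → Em m) (n : ℕ) (h : Der u n v) (i : ℕ) :
    Der u (i + n) (pt^[i] v) := by
  induction i with
  | zero => simpa using h
  | succ i ih =>
    rw [Function.iterate_succ_apply', show i + 1 + n = (i + n) + 1 by ring]
    exact Der.succ ih (Or.inl rfl)

lemma smooth_foldr {u : ℝ × Ed d → Em m} (hu : ContDiff ℝ (⊤ : ℕ∞) u) (l : List (Fin d)) :
    ContDiff ℝ (⊤ : ℕ∞) (l.foldr pd u) := by
  induction l with
  | nil => exact hu
  | cons a l ih => exact smooth_pd a ih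

lemma smooth_iter {u : ℝ × Ed d → Em m} (hu : ContDiff ℝ (⊤ : ℕ∞) u) (i : ℕ) :
    ContDiff ℝ (⊤ : ℕ∞) (pt^[i] u) := by
  induction i with
  | zero => exact hu
  | succ i ih => rw [Function.iterate_succ_apply']; exact smooth_pt ih

lemma foldr_comm {u : ℝ × Ed d → Em m} (hu : ContDiff ℝ (⊤ : ℕ∞) u) (l : List (Fin d))
    (k : Fin d) : l.foldr pd (pd k u) = pd k (l.foldr pd u) := by
  induction l with
  | nil => rfl
  | cons a l ih =>
    simp only [List.foldr_cons, ih]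
    exact dw_comm _ _ (smooth_foldr hu l)

lemma iter_comm {u : ℝ × Ed d → Em m} (hu : ContDiff ℝ (⊤ : ℕ∞) u) (i : ℕ)
    (k : Fin d) : pt^[i] (pd k u) = pd k (pt^[i] u) := by
  induction i with
  | zero => rfl
  | succ i ih =>
    rw [Function.iterate_succ_apply', Function.iterate_succ_apply', ih]
    exact dw_comm _ _ (smooth_iter hu i)

end fin

/-- Interior estimates of higher derivatives for homogeneous systems
whose coefficients depend only on `x₁`: for nonnegative integers `i + j ≥ 1` and any
`j`-fold derivative `D_{x'}^j` in the directions `x₂, …, x_d`,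
`‖∂_t^i D_{x'}^j u‖_{L₂(Q_r)} + ‖∂_t^i D_{x'}^j D₁ u‖_{L₂(Q_r)} ≤ N‖Du‖_{L₂(Q_R)}`
with `N = N(d,m,δ,R,r,i,j)`. -/
theorem stmt_6
    (d m : ℕ) [NeZero d] [NeZero m] (δ : ℝ) (hδ : δ ∈ Set.Ioc (0:ℝ) 1)
    (r R : ℝ) (hr : 0 < r) (hrR : r < R) (i j : ℕ) (hij : 1 ≤ i + j) :
    ∃ N : ℝ, 0 < N ∧
    ∀ (Ab : Fin d → Fin d → ℝ → CLM m), CoeffsOne δ Ab →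
    ∀ u : ℝ × Ed d → Em m, ContDiff ℝ (⊤ : ℕ∞) u →
    -- `-u_t + D_α(Ā^{αβ}(x₁)D_βu) = 0` weakly in `Q_R`
    (∀ φt : ℝ × Ed d → Em m, ContDiff ℝ (⊤ : ℕ∞) φt → HasCompactSupport φt →
      tsupport φt ⊆ Qc0 R →
      ∫ q, (⟪u q, pt φt q⟫ - ∑ α, ∑ β, ⟪Ab α β (q.2 0) (pd β u q), pd α φt q⟫) = 0) →
    ∀ l : List (Fin d), l.length = j → (∀ β ∈ l, β ≠ 0) →
      Real.sqrt (∫ q in Qc0 (d := d) r, ‖pt^[i] (l.foldr pd u) q‖ ^ 2)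
        + Real.sqrt (∫ q in Qc0 (d := d) r, ‖pt^[i] (l.foldr pd (pd 0 u)) q‖ ^ 2)
        ≤ N * Real.sqrt (∫ q in Qc0 (d := d) R, gradSq u q) := by
  obtain ⟨n, hn⟩ : ∃ n, i + j = n + 1 := ⟨i + j - 1, by omega⟩
  obtain ⟨ρ, h1, h2⟩ := exists_between hrR
  obtain ⟨N1, hN1, H1⟩ := der_est d m hδ.1 n (hr.trans h1) h2
  obtain ⟨N2, hN2, H2⟩ := step_est d m hδ.1 hr h1
  refine ⟨2 * Real.sqrt (N2 * N1) + 1, by positivity, ?_⟩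
  intro Ab hA u hu hweak l hl hl0
  have hsol : Sol Ab R u := ⟨hu, hweak⟩
  have hD : Der u (n + 1) (pt^[i] (l.foldr pd u)) := by
    have := der_iter u _ _ (der_foldr u l hl0) i
    rwa [hl, hn] at this
  rw [foldr_comm hu, iter_comm (smooth_foldr hu l)]
  set w := pt^[i] (l.foldr pd u) with hw
  set I := ∫ q in Qc0 (d := d) R, gradSq u q with hI
  have hI0 : 0 ≤ I := integral_nonneg fun q => gradSq_nonneg u q
  cases hD with
  | succ hD' hs =>
    obtain ⟨hv, e1⟩ := H1 Ab hA u _ hsol hD'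
    obtain ⟨hws, e2, e3⟩ := H2 Ab hA _ _ (hv.mono (hr.trans h1) h2.le) hs
    have hle := mul_le_mul_of_nonneg_left e1 hN2
    rw [← mul_assoc] at hle
    have e4 : ∫ q in Qc0 (d := d) r, ‖pd 0 w q‖ ^ 2 ≤ N2 * N1 * I := by
      refine le_trans ?_ (e3.trans hle)
      have hc := (smooth_pd 0 hws.1).continuous
      exact setIntegral_mono (intQ (by fun_prop)) (intQ (cont_gradSq hws.1))
        fun q => le_gradSq w q 0
    have s1 := Real.sqrt_le_sqrt (e2.trans hle)
    have s2 := Real.sqrt_le_sqrt e4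
    rw [Real.sqrt_mul (by positivity)] at s1 s2
    have := Real.sqrt_nonneg I
    linarith
end
end

section
/- Let 0 < r < R < ∞ and suppose the coefficients depend only on x_1: A^{αβ}(t,x) = Ā^{αβ}(x_1). Suppose u : ℝ^{1+d} → ℝ^m is smooth and satisfies −u_t + D_α(A^{αβ}D_βu) = 0 weakly in Q_R. Then ‖∂_t u‖_{L_2(Q_r)} ≤ N ‖Du‖_{L_2(Q_R)}, where N = N(d,m,δ,R,r). -/
open MeasureTheory Metric Set Function
open scoped ENNReal NNReal RealInnerProductSpace BigOperators

noncomputable section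

/-! ### Smoothness and supports of the partial derivatives -/

lemma pd_smooth {d : ℕ} {F : Type*} [NormedAddCommGroup F] [NormedSpace ℝ F]
    (α : Fin d) {u : ℝ × Ed d → F} (hu : ContDiff ℝ (⊤ : ℕ∞) u) :
    ContDiff ℝ (⊤ : ℕ∞) (pd α u) := by
  have h : ContDiff ℝ (⊤ : ℕ∞) (fderiv ℝ u) := hu.fderiv_right (by simp)
  exact h.clm_apply contDiff_const

lemma pt_smooth {d : ℕ} {F : Type*} [NormedAddCommGroup F] [NormedSpace ℝ F]
    {u : ℝ × Ed d → F} (hu : ContDiff ℝ (⊤ : ℕ∞) u) :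
    ContDiff ℝ (⊤ : ℕ∞) (pt u) := by
  have h : ContDiff ℝ (⊤ : ℕ∞) (fderiv ℝ u) := hu.fderiv_right (by simp)
  exact h.clm_apply contDiff_const

lemma pt_tsupport {d : ℕ} {F : Type*} [NormedAddCommGroup F] [NormedSpace ℝ F]
    (u : ℝ × Ed d → F) : tsupport (pt u) ⊆ tsupport u :=
  tsupport_fderiv_apply_subset ℝ _

lemma pd_tsupport {d : ℕ} {F : Type*} [NormedAddCommGroup F] [NormedSpace ℝ F]
    (α : Fin d) (u : ℝ × Ed d → F) : tsupport (pd α u) ⊆ tsupport u :=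
  tsupport_fderiv_apply_subset ℝ _

lemma pt_hcs {d : ℕ} {F : Type*} [NormedAddCommGroup F] [NormedSpace ℝ F]
    {u : ℝ × Ed d → F} (h : HasCompactSupport u) : HasCompactSupport (pt u) :=
  h.of_isClosed_subset (isClosed_tsupport _) (pt_tsupport u)

lemma pd_hcs {d : ℕ} {F : Type*} [NormedAddCommGroup F] [NormedSpace ℝ F]
    (α : Fin d) {u : ℝ × Ed d → F} (h : HasCompactSupport u) : HasCompactSupport (pd α u) :=
  h.of_isClosed_subset (isClosed_tsupport _) (pd_tsupport α u)

lemma pt_pd_comm {d : ℕ} {F : Type*} [NormedAddCommGroup F] [NormedSpace ℝ F]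
    (α : Fin d) {u : ℝ × Ed d → F} (hu : ContDiff ℝ (⊤ : ℕ∞) u) (q : ℝ × Ed d) :
    pt (pd α u) q = pd α (pt u) q := by
  have h : ContDiff ℝ (⊤ : ℕ∞) (fderiv ℝ u) := hu.fderiv_right (by simp)
  have hd : DifferentiableAt ℝ (fderiv ℝ u) q := (h.differentiable (by simp)) q
  have key : ∀ a b : ℝ × Ed d, fderiv ℝ (fun p => fderiv ℝ u p a) q b
      = fderiv ℝ (fderiv ℝ u) q b a := by
    intro a b
    rw [fderiv_clm_apply hd (differentiableAt_const a)]
    simp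
  have hs : IsSymmSndFDerivAt ℝ u q :=
    hu.contDiffAt.isSymmSndFDerivAt (by
      rw [minSmoothness_of_isRCLikeNormedField]; exact WithTop.coe_le_coe.2 (le_top : (2 : ℕ∞) ≤ ⊤))
  change fderiv ℝ (fun p => fderiv ℝ u p (0, EuclideanSpace.single α 1)) q (1, 0)
    = fderiv ℝ (fun p => fderiv ℝ u p (1, 0)) q (0, EuclideanSpace.single α 1)
  rw [key, key]
  exact hs.eq _ _

lemma pt_line {d : ℕ} {F : Type*} [NormedAddCommGroup F] [NormedSpace ℝ F]
    {u : ℝ × Ed d → F} (hu : ContDiff ℝ (⊤ : ℕ∞) u) (q : ℝ × Ed d) :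
    HasLineDerivAt ℝ u (pt u q) q (1, 0) :=
  ((hu.differentiable (by simp)) q).hasFDerivAt.hasLineDerivAt _

lemma pt_smul {d : ℕ} {F : Type*} [NormedAddCommGroup F] [NormedSpace ℝ F]
    {f : ℝ × Ed d → ℝ} {u : ℝ × Ed d → F} (hf : ContDiff ℝ (⊤ : ℕ∞) f)
    (hu : ContDiff ℝ (⊤ : ℕ∞) u) (q : ℝ × Ed d) :
    pt (fun p => f p • u p) q = f q • pt u q + pt f q • u q := by
  unfold pt
  rw [fderiv_fun_smul ((hf.differentiable (by simp)) q) ((hu.differentiable (by simp)) q)]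
  simp

lemma pd_smul {d : ℕ} {F : Type*} [NormedAddCommGroup F] [NormedSpace ℝ F]
    (α : Fin d) {f : ℝ × Ed d → ℝ} {u : ℝ × Ed d → F} (hf : ContDiff ℝ (⊤ : ℕ∞) f)
    (hu : ContDiff ℝ (⊤ : ℕ∞) u) (q : ℝ × Ed d) :
    pd α (fun p => f p • u p) q = f q • pd α u q + pd α f q • u q := by
  unfold pd
  rw [fderiv_fun_smul ((hf.differentiable (by simp)) q) ((hu.differentiable (by simp)) q)]
  simp

lemma pt_pow {d : ℕ} (n : ℕ) {f : ℝ × Ed d → ℝ} (hf : ContDiff ℝ (⊤ : ℕ∞) f) (q : ℝ × Ed d) :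
    pt (fun p => f p ^ n) q = n * f q ^ (n - 1) * pt f q := by
  unfold pt
  rw [fderiv_fun_pow n ((hf.differentiable (by simp)) q)]
  simp

lemma pd_pow {d : ℕ} (α : Fin d) (n : ℕ) {f : ℝ × Ed d → ℝ} (hf : ContDiff ℝ (⊤ : ℕ∞) f)
    (q : ℝ × Ed d) :
    pd α (fun p => f p ^ n) q = n * f q ^ (n - 1) * pd α f q := by
  unfold pd
  rw [fderiv_fun_pow n ((hf.differentiable (by simp)) q)]
  simp

lemma integral_line_zero {d : ℕ} {F F' : ℝ × Ed d → ℝ} (hF : Integrable F)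
    (hF' : Integrable F') (h : ∀ q, HasLineDerivAt ℝ F (F' q) q (1, 0)) : ∫ q, F' q = 0 := by
  have : (volume : Measure (ℝ × Ed d)).IsAddHaarMeasure := by
    rw [Measure.volume_eq_prod]; infer_instance
  have := integral_bilinear_hasLineDerivAt_right_eq_neg_left_of_integrable
    (μ := (volume : Measure (ℝ × Ed d))) (f := F) (f' := F') (g := fun _ => (1:ℝ))
    (g' := fun _ => (0:ℝ)) (v := ((1:ℝ), (0 : Ed d))) (B := ContinuousLinearMap.mul ℝ ℝ)
    (by simpa using hF') (by simp) (by simpa using hF) (fun q _ => h q)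
    (fun q _ => by
      simpa [HasLineDerivAt] using hasDerivAt_const (0:ℝ) (1:ℝ))
  simpa using this

/-! ### The bilinear form -/

/-- The form `∑ ⟪A^{αβ}(x₁) X_β, Y_α⟫`. -/
def bf {d m : ℕ} [NeZero d] (Ab : Fin d → Fin d → ℝ → CLM m)
    (X Y : Fin d → ℝ × Ed d → Em m) (q : ℝ × Ed d) : ℝ :=
  ∑ α, ∑ β, ⟪Ab α β (q.2 0) (X β q), Y α q⟫

lemma bf_integrable {d m : ℕ} [NeZero d] {δ : ℝ} {Ab : Fin d → Fin d → ℝ → CLM m}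
    (hA : CoeffsOne δ Ab) {X Y : Fin d → ℝ × Ed d → Em m}
    (hX : ∀ α, Continuous (X α)) (hY : ∀ α, Continuous (Y α))
    (hc : ∀ α, HasCompactSupport (Y α)) : Integrable (bf Ab X Y) := by
  unfold bf
  refine integrable_finsetSum _ fun α _ => integrable_finsetSum _ fun β _ => ?_
  have hg : Integrable (fun q => δ⁻¹ * ‖X β q‖ * ‖Y α q‖) := by
    apply Continuous.integrable_of_hasCompactSupport
    · have := hX β
      have := hY α
      fun_prop
    · exact ((hc α).norm).mul_left
  refine hg.mono' ?_ (Filter.Eventually.of_forall fun q => ?_)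
  · have h0 : Measurable fun q : ℝ × Ed d => Ab α β (q.2 0) :=
      (hA.1 α β).comp (by fun_prop)
    have h1 : Measurable fun q : ℝ × Ed d => Ab α β (q.2 0) (X β q) :=
      (isBoundedBilinearMap_apply (𝕜 := ℝ) (E := Em m) (F := Em m)).continuous.measurable.comp
        (h0.prodMk (hX β).measurable)
    exact (h1.inner (hY α).measurable).aestronglyMeasurable
  · calc ‖⟪Ab α β (q.2 0) (X β q), Y α q⟫‖ ≤ ‖Ab α β (q.2 0) (X β q)‖ * ‖Y α q‖ :=
          norm_inner_le_norm _ _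
      _ ≤ δ⁻¹ * ‖X β q‖ * ‖Y α q‖ := by
          gcongr
          exact (Ab α β (q.2 0)).le_of_opNorm_le ((hA.2 _).1 α β) _

lemma bf_line {d m : ℕ} [NeZero d] {Ab : Fin d → Fin d → ℝ → CLM m}
    {X Y : Fin d → ℝ × Ed d → Em m}
    (hX : ∀ α, ContDiff ℝ (⊤ : ℕ∞) (X α)) (hY : ∀ α, ContDiff ℝ (⊤ : ℕ∞) (Y α))
    (q : ℝ × Ed d) :
    HasLineDerivAt ℝ (bf Ab X Y)
      (bf Ab X (fun α => pt (Y α)) q + bf Ab (fun α => pt (X α)) Y q) q (1, 0) := by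
  unfold bf
  rw [← Finset.sum_add_distrib]
  simp_rw [← Finset.sum_add_distrib]
  unfold HasLineDerivAt
  refine HasDerivAt.fun_sum fun α _ => HasDerivAt.fun_sum fun β _ => ?_
  have h1 := pt_line (hX β) q
  have h2 := pt_line (hY α) q
  unfold HasLineDerivAt at h1 h2
  have h3 := ((Ab α β (q.2 0)).hasFDerivAt.comp_hasDerivAt (0:ℝ) h1).inner ℝ h2
  have hz : q + ((0:ℝ), (0 : Ed d)) = q := by ext <;> simp
  simpa [hz] using h3

/-- Strong-in-time form of the equation. -/
lemma eq_one {d m : ℕ} [NeZero d] {δ R : ℝ} {Ab : Fin d → Fin d → ℝ → CLM m}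
    (hA : CoeffsOne δ Ab) {u : ℝ × Ed d → Em m} (hu : ContDiff ℝ (⊤ : ℕ∞) u)
    (hw : ∀ φt : ℝ × Ed d → Em m, ContDiff ℝ (⊤ : ℕ∞) φt → HasCompactSupport φt →
      tsupport φt ⊆ Qc0 R →
      ∫ q, (⟪u q, pt φt q⟫ - ∑ α, ∑ β, ⟪Ab α β (q.2 0) (pd β u q), pd α φt q⟫) = 0)
    {φ : ℝ × Ed d → Em m} (hφ : ContDiff ℝ (⊤ : ℕ∞) φ) (hc : HasCompactSupport φ)
    (hs : tsupport φ ⊆ Qc0 R) :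
    (∫ q, ⟪pt u q, φ q⟫) + ∫ q, bf Ab (fun α => pd α u) (fun α => pd α φ) q = 0 := by
  have h := hw φ hφ hc hs
  have ib : Integrable (bf Ab (fun α => pd α u) (fun α => pd α φ)) :=
    bf_integrable hA (fun α => (pd_smooth α hu).continuous) (fun α => (pd_smooth α hφ).continuous)
      (fun α => pd_hcs α hc)
  have i1 : Integrable fun q => ⟪u q, pt φ q⟫ :=
    (hu.continuous.inner (pt_smooth hφ).continuous).integrable_of_hasCompactSupport
      ((pt_hcs hc).mono' (fun q hq => subset_tsupport _ (fun h0 => hq (by simp [h0]))))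
  have i2 : Integrable fun q => ⟪pt u q, φ q⟫ :=
    ((pt_smooth hu).continuous.inner hφ.continuous).integrable_of_hasCompactSupport
      (hc.mono' (fun q hq => subset_tsupport _ (fun h0 => hq (by simp [h0]))))
  have i3 : Integrable fun q => ⟪u q, φ q⟫ :=
    (hu.continuous.inner hφ.continuous).integrable_of_hasCompactSupport
      (hc.mono' (fun q hq => subset_tsupport _ (fun h0 => hq (by simp [h0]))))
  have h2 : ∫ q, (⟪u q, pt φ q⟫ + ⟪pt u q, φ q⟫) = 0 := by
    refine integral_line_zero i3 (i1.add i2) fun q => ?_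
    have a1 := pt_line hu q
    have a2 := pt_line hφ q
    unfold HasLineDerivAt at a1 a2 ⊢
    simpa using a1.inner ℝ a2
  rw [integral_add i1 i2] at h2
  have h' : ∫ q, (⟪u q, pt φ q⟫ - bf Ab (fun α => pd α u) (fun α => pd α φ) q) = 0 := h
  rw [integral_sub i1 ib] at h'
  linarith

/-- The equation satisfied by `∂_t u`. -/
lemma eq_two {d m : ℕ} [NeZero d] {δ R : ℝ} {Ab : Fin d → Fin d → ℝ → CLM m}
    (hA : CoeffsOne δ Ab) {u : ℝ × Ed d → Em m} (hu : ContDiff ℝ (⊤ : ℕ∞) u)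
    (hw : ∀ φt : ℝ × Ed d → Em m, ContDiff ℝ (⊤ : ℕ∞) φt → HasCompactSupport φt →
      tsupport φt ⊆ Qc0 R →
      ∫ q, (⟪u q, pt φt q⟫ - ∑ α, ∑ β, ⟪Ab α β (q.2 0) (pd β u q), pd α φt q⟫) = 0)
    {φ : ℝ × Ed d → Em m} (hφ : ContDiff ℝ (⊤ : ℕ∞) φ) (hc : HasCompactSupport φ)
    (hs : tsupport φ ⊆ Qc0 R) :
    (∫ q, ⟪pt u q, pt φ q⟫) = ∫ q, bf Ab (fun α => pd α (pt u)) (fun α => pd α φ) q := by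
  have h1 := eq_one hA hu hw (pt_smooth hφ) (pt_hcs hc) ((pt_tsupport φ).trans hs)
  have e1 : (fun α => pt (pd α φ)) = fun α => pd α (pt φ) := by
    funext α q; exact pt_pd_comm α hφ q
  have e2 : (fun α => pt (pd α u)) = fun α => pd α (pt u) := by
    funext α q; exact pt_pd_comm α hu q
  have c1 := fun α => (pd_smooth α hu).continuous
  have c2 := fun α => (pd_smooth α hφ).continuous
  have c3 := fun α => (pd_smooth α (pt_smooth hu)).continuous
  have c4 := fun α => (pd_smooth α (pt_smooth hφ)).continuous
  have h2 := integral_line_zero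
    (bf_integrable hA c1 c2 (fun α => pd_hcs α hc))
    ((bf_integrable hA c1 c4 (fun α => pd_hcs α (pt_hcs hc))).add
      (bf_integrable hA c3 c2 (fun α => pd_hcs α hc)))
    (fun q => by
      have := bf_line (Ab := Ab) (fun α => pd_smooth α hu) (fun α => pd_smooth α hφ) q
      rw [e1, e2] at this
      exact this)
  rw [integral_add' (bf_integrable hA c1 c4 (fun α => pd_hcs α (pt_hcs hc)))
      (bf_integrable hA c3 c2 (fun α => pd_hcs α hc))] at h2
  linarith

/-! ### Pointwise inequalities -/

lemma pointwise_one {d m : ℕ} {δ : ℝ} (hδ : 0 < δ) {a : Fin d → Fin d → CLM m}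
    (ha : EllipticPt δ a) (g h : Fin d → Em m) (v : Em m) (z : ℝ) (hz : 0 ≤ z)
    (zd : Fin d → ℝ) (L : ℝ) (hL : ∀ α, |zd α| ≤ L) (lam mu : ℝ) (hl : 0 < lam) (hm : 0 < mu) :
    -(∑ α, ∑ β, ⟪a α β (g β), z ^ 2 • h α + (2 * z * zd α) • v⟫) ≤
      d * lam * (z ^ 4 * ∑ α, ‖h α‖ ^ 2) + d ^ 2 * mu * (z ^ 2 * ‖v‖ ^ 2)
        + d * (δ⁻¹ ^ 2 / (4 * lam) + δ⁻¹ ^ 2 * L ^ 2 / mu) * ∑ β, ‖g β‖ ^ 2 := by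
  have hδ' : 0 < δ⁻¹ := inv_pos.mpr hδ
  have key : ∀ α β, -⟪a α β (g β), z ^ 2 • h α + (2 * z * zd α) • v⟫ ≤
      lam * (z ^ 4 * ‖h α‖ ^ 2) + mu * (z ^ 2 * ‖v‖ ^ 2)
        + (δ⁻¹ ^ 2 / (4 * lam) + δ⁻¹ ^ 2 * L ^ 2 / mu) * ‖g β‖ ^ 2 := by
    intro α β
    have hL0 : 0 ≤ L := (abs_nonneg _).trans (hL α)
    have h1 : ‖a α β (g β)‖ ≤ δ⁻¹ * ‖g β‖ := (a α β).le_of_opNorm_le (ha.1 α β) _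
    have h2 : ‖z ^ 2 • h α + (2 * z * zd α) • v‖ ≤ z ^ 2 * ‖h α‖ + 2 * z * L * ‖v‖ := by
      refine (norm_add_le _ _).trans ?_
      rw [norm_smul, norm_smul, Real.norm_eq_abs, Real.norm_eq_abs, abs_mul, abs_mul,
        abs_of_nonneg (sq_nonneg z), abs_of_nonneg hz, abs_two]
      have := hL α
      gcongr
    have h3 : -⟪a α β (g β), z ^ 2 • h α + (2 * z * zd α) • v⟫ ≤
        (δ⁻¹ * ‖g β‖) * (z ^ 2 * ‖h α‖ + 2 * z * L * ‖v‖) := by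
      refine (neg_le_abs _).trans ((abs_real_inner_le_norm _ _).trans ?_)
      gcongr
    have h4 : (δ⁻¹ * ‖g β‖) * (z ^ 2 * ‖h α‖) ≤
        lam * (z ^ 4 * ‖h α‖ ^ 2) + δ⁻¹ ^ 2 / (4 * lam) * ‖g β‖ ^ 2 := by
      have e : lam * (z ^ 4 * ‖h α‖ ^ 2) + δ⁻¹ ^ 2 / (4 * lam) * ‖g β‖ ^ 2
          - (δ⁻¹ * ‖g β‖) * (z ^ 2 * ‖h α‖)
          = (2 * lam * (z ^ 2 * ‖h α‖) - δ⁻¹ * ‖g β‖) ^ 2 / (4 * lam) := by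
        generalize δ⁻¹ = D
        field_simp
        ring
      have : 0 ≤ (2 * lam * (z ^ 2 * ‖h α‖) - δ⁻¹ * ‖g β‖) ^ 2 / (4 * lam) := by positivity
      linarith
    have h5 : (δ⁻¹ * ‖g β‖) * (2 * z * L * ‖v‖) ≤
        mu * (z ^ 2 * ‖v‖ ^ 2) + δ⁻¹ ^ 2 * L ^ 2 / mu * ‖g β‖ ^ 2 := by
      have e : mu * (z ^ 2 * ‖v‖ ^ 2) + δ⁻¹ ^ 2 * L ^ 2 / mu * ‖g β‖ ^ 2
          - (δ⁻¹ * ‖g β‖) * (2 * z * L * ‖v‖)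
          = (mu * (z * ‖v‖) - δ⁻¹ * L * ‖g β‖) ^ 2 / mu := by
        generalize δ⁻¹ = D
        field_simp
        ring
      have : 0 ≤ (mu * (z * ‖v‖) - δ⁻¹ * L * ‖g β‖) ^ 2 / mu := by positivity
      linarith
    linarith
  rw [← Finset.sum_neg_distrib]
  simp_rw [← Finset.sum_neg_distrib]
  refine (Finset.sum_le_sum fun α _ => Finset.sum_le_sum fun β _ => key α β).trans (le_of_eq ?_)
  simp only [Finset.sum_add_distrib, Finset.sum_const, Finset.card_univ, Fintype.card_fin,
    nsmul_eq_mul, ← Finset.mul_sum]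
  ring

lemma pointwise_two {d m : ℕ} [NeZero d] {δ : ℝ} (hδ : 0 < δ) {a : Fin d → Fin d → CLM m}
    (ha : EllipticPt δ a) (h : Fin d → Em m) (v : Em m) (z : ℝ) (hz : 0 ≤ z)
    (zd : Fin d → ℝ) (L : ℝ) (hL : ∀ α, |zd α| ≤ L) :
    δ / 2 * (z ^ 4 * ∑ α, ‖h α‖ ^ 2) ≤
      (∑ α, ∑ β, ⟪a α β (h β), z ^ 4 • h α + (4 * z ^ 3 * zd α) • v⟫)
        + 8 * d ^ 3 * L ^ 2 * δ⁻¹ ^ 3 * (z ^ 2 * ‖v‖ ^ 2) := by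
  have hδ' : 0 < δ⁻¹ := inv_pos.mpr hδ
  have hd : (0:ℝ) < d := by exact_mod_cast Nat.pos_of_ne_zero (NeZero.ne d)
  have key : ∀ α β, z ^ 4 * ⟪h α, a α β (h β)⟫ ≤
      ⟪a α β (h β), z ^ 4 • h α + (4 * z ^ 3 * zd α) • v⟫
        + (δ / (2 * d) * (z ^ 4 * ‖h β‖ ^ 2) + 8 * d * L ^ 2 * δ⁻¹ ^ 3 * (z ^ 2 * ‖v‖ ^ 2)) := by
    intro α β
    have hL0 : 0 ≤ L := (abs_nonneg _).trans (hL α)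
    have h1 : ‖a α β (h β)‖ ≤ δ⁻¹ * ‖h β‖ := (a α β).le_of_opNorm_le (ha.1 α β) _
    rw [inner_add_right, real_inner_smul_right, real_inner_smul_right,
      real_inner_comm (a α β (h β)) (h α)]
    have h3 : -(4 * z ^ 3 * zd α * ⟪a α β (h β), v⟫) ≤
        4 * z ^ 3 * L * ((δ⁻¹ * ‖h β‖) * ‖v‖) := by
      refine (neg_le_abs _).trans ?_
      rw [abs_mul, abs_mul, abs_of_nonneg (by positivity : 0 ≤ 4 * z ^ 3)]
      have h2 := abs_real_inner_le_norm (a α β (h β)) v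
      have := hL α
      have h4 : |⟪a α β (h β), v⟫| ≤ (δ⁻¹ * ‖h β‖) * ‖v‖ := h2.trans (by gcongr)
      gcongr
    have h5 : 4 * z ^ 3 * L * ((δ⁻¹ * ‖h β‖) * ‖v‖) ≤
        δ / (2 * d) * (z ^ 4 * ‖h β‖ ^ 2) + 8 * d * L ^ 2 * δ⁻¹ ^ 3 * (z ^ 2 * ‖v‖ ^ 2) := by
      have e : δ / (2 * d) * (z ^ 4 * ‖h β‖ ^ 2) + 8 * d * L ^ 2 * δ⁻¹ ^ 3 * (z ^ 2 * ‖v‖ ^ 2)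
          - 4 * z ^ 3 * L * ((δ⁻¹ * ‖h β‖) * ‖v‖)
          = δ / (2 * d) * (z ^ 2 * ‖h β‖ - 4 * d * L * δ⁻¹ ^ 2 * (z * ‖v‖)) ^ 2 := by
        field_simp
        ring
      have : 0 ≤ δ / (2 * d) * (z ^ 2 * ‖h β‖ - 4 * d * L * δ⁻¹ ^ 2 * (z * ‖v‖)) ^ 2 := by
        positivity
      linarith
    linarith
  have hell : z ^ 4 * (δ * ∑ α, ‖h α‖ ^ 2) ≤ z ^ 4 * ∑ α, ∑ β, ⟪h α, a α β (h β)⟫ := by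
    have := ha.2 h
    gcongr
  have hsum := Finset.sum_le_sum fun α (_ : α ∈ Finset.univ) =>
    Finset.sum_le_sum fun β (_ : β ∈ Finset.univ) => key α β
  simp only [Finset.sum_add_distrib, Finset.sum_const, Finset.card_univ, Fintype.card_fin,
    nsmul_eq_mul, ← Finset.mul_sum] at hsum
  have e : (d:ℝ) * (δ / (2 * d) * (z ^ 4 * ∑ α, ‖h α‖ ^ 2))
      = δ / 2 * (z ^ 4 * ∑ α, ‖h α‖ ^ 2) := by
    field_simp
  rw [e] at hsum
  linarith

/-! ### The main estimate with a cutoff function -/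

lemma gradSq_continuous {d m : ℕ} {u : ℝ × Ed d → Em m} (hu : ContDiff ℝ (⊤ : ℕ∞) u) :
    Continuous (gradSq u) := by
  unfold gradSq
  exact continuous_finsetSum _ fun α _ => ((pd_smooth α hu).continuous.norm).pow 2

lemma Qc0_measurable {d : ℕ} (R : ℝ) : MeasurableSet (Qc0 (d := d) R) :=
  measurableSet_Ioo.prod measurableSet_ball

lemma integrableOn_Qc0 {d : ℕ} {f : ℝ × Ed d → ℝ} (hf : Continuous f) (R : ℝ) :
    IntegrableOn f (Qc0 R) := by
  have hK : IsCompact (Icc (0 - R ^ 2) 0 ×ˢ closedBall (0 : Ed d) R) :=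
    isCompact_Icc.prod (isCompact_closedBall _ _)
  exact (hf.continuousOn.integrableOn_compact hK).mono_set
    (Set.prod_mono Ioo_subset_Icc_self ball_subset_closedBall)

lemma main_est (d m : ℕ) [NeZero d] (δ : ℝ) (hδ : 0 < δ) (R K L : ℝ) (hK : 0 ≤ K) :
    ∃ C : ℝ, 0 < C ∧ ∀ (Ab : Fin d → Fin d → ℝ → CLM m), CoeffsOne δ Ab →
    ∀ u : ℝ × Ed d → Em m, ContDiff ℝ (⊤ : ℕ∞) u →
    (∀ φt : ℝ × Ed d → Em m, ContDiff ℝ (⊤ : ℕ∞) φt → HasCompactSupport φt →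
      tsupport φt ⊆ Qc0 R →
      ∫ q, (⟪u q, pt φt q⟫ - ∑ α, ∑ β, ⟪Ab α β (q.2 0) (pd β u q), pd α φt q⟫) = 0) →
    ∀ ζ : ℝ × Ed d → ℝ, ContDiff ℝ (⊤ : ℕ∞) ζ → HasCompactSupport ζ → tsupport ζ ⊆ Qc0 R →
    (∀ q, 0 ≤ ζ q) → (∀ q, ζ q ≤ 1) → (∀ q, 0 < ζ q → pt ζ q ≤ K) →
    (∀ α q, |pd α ζ q| ≤ L) →
    ∫ q, ζ q ^ 2 * ‖pt u q‖ ^ 2 ≤ C * ∫ q in Qc0 (d := d) R, gradSq u q := by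
  have hd : (0:ℝ) < d := by exact_mod_cast Nat.pos_of_ne_zero (NeZero.ne d)
  have hδ' : 0 < δ⁻¹ := inv_pos.mpr hδ
  set C2 : ℝ := 2 / δ * (2 * K + 8 * d ^ 3 * L ^ 2 * δ⁻¹ ^ 3) with hC2
  have hC20 : 0 ≤ C2 := by positivity
  set mu : ℝ := 1 / (4 * d ^ 2) with hmu
  set lam : ℝ := 1 / (4 * d * (C2 + 1)) with hlam
  have hmu0 : 0 < mu := by positivity
  have hlam0 : 0 < lam := by positivity
  set C1 : ℝ := d * (δ⁻¹ ^ 2 / (4 * lam) + δ⁻¹ ^ 2 * L ^ 2 / mu) with hC1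
  have hC10 : 0 < C1 := by positivity
  refine ⟨2 * C1, by positivity, ?_⟩
  intro Ab hA u hu hw ζ hζ hζc hζs hζ0 hζ1 hζt hζd
  have hv : ContDiff ℝ (⊤ : ℕ∞) (pt u) := pt_smooth hu
  have hvd := fun α => pd_smooth α hv
  have zout : ∀ q, q ∉ Qc0 R → ζ q = 0 := fun q hq =>
    image_eq_zero_of_notMem_tsupport fun h => hq (hζs h)
  -- generic compact support facts
  have hcs : ∀ {F : Type} [NormedAddCommGroup F] (f : ℝ × Ed d → F),
      (∀ q, ζ q = 0 → f q = 0) → HasCompactSupport f := fun f hf =>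
    hζc.mono' (fun q hq => subset_tsupport _ (fun h0 => hq (hf q h0)))
  have hts : ∀ {F : Type} [NormedAddCommGroup F] (f : ℝ × Ed d → F),
      (∀ q, ζ q = 0 → f q = 0) → tsupport f ⊆ Qc0 R := by
    intro F _ f hf
    have hsub : support f ⊆ support ζ := fun q hq h0 => hq (hf q h0)
    exact (closure_mono hsub).trans hζs
  -- the quantities
  have cv := hv.continuous
  have cz := hζ.continuous
  have czt := (pt_smooth hζ).continuous
  have cH : Continuous fun q => gradSq (pt u) q := gradSq_continuous hv
  have iX : Integrable fun q => ζ q ^ 2 * ‖pt u q‖ ^ 2 :=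
    Continuous.integrable_of_hasCompactSupport (by fun_prop) (hcs _ (by intro q h; simp [h]))
  have iY : Integrable fun q => ζ q ^ 4 * gradSq (pt u) q :=
    Continuous.integrable_of_hasCompactSupport (by fun_prop) (hcs _ (by intro q h; simp [h]))
  have iG : Integrable ((Qc0 (d := d) R).indicator (gradSq u)) :=
    (integrableOn_Qc0 (gradSq_continuous hu) R).integrable_indicator (Qc0_measurable R)
  set X := ∫ q, ζ q ^ 2 * ‖pt u q‖ ^ 2 with hX
  set Y := ∫ q, ζ q ^ 4 * gradSq (pt u) q with hY
  have eG : ∫ q, (Qc0 (d := d) R).indicator (gradSq u) q = ∫ q in Qc0 (d := d) R, gradSq u q :=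
    integral_indicator (Qc0_measurable R)
  set G := ∫ q in Qc0 (d := d) R, gradSq u q with hG
  have hX0 : 0 ≤ X := integral_nonneg fun q => by positivity
  -- first test function
  have step1 : X ≤ d * lam * Y + d ^ 2 * mu * X + C1 * G := by
    have hz2 : ContDiff ℝ (⊤ : ℕ∞) fun q => ζ q ^ 2 := hζ.pow 2
    have hφ : ContDiff ℝ (⊤ : ℕ∞) fun q => ζ q ^ 2 • pt u q := hz2.smul hv
    have hφc : HasCompactSupport fun q => ζ q ^ 2 • pt u q :=
      hcs _ (by intro q h; simp [h])
    have h := eq_one hA hu hw hφ hφc (hts _ (by intro q h; simp [h]))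
    have e1 : ∫ q, ⟪pt u q, ζ q ^ 2 • pt u q⟫ = X := by
      refine integral_congr_ae (Filter.Eventually.of_forall fun q => ?_)
      simp only [real_inner_smul_right, real_inner_self_eq_norm_sq]
    rw [e1] at h
    have ib : Integrable (bf Ab (fun α => pd α u) (fun α => pd α fun q => ζ q ^ 2 • pt u q)) :=
      bf_integrable hA (fun α => (pd_smooth α hu).continuous)
        (fun α => (pd_smooth α hφ).continuous) (fun α => pd_hcs α hφc)
    have hle : ∫ q, -bf Ab (fun α => pd α u) (fun α => pd α fun q => ζ q ^ 2 • pt u q) q ≤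
        ∫ q, (d * lam * (ζ q ^ 4 * gradSq (pt u) q) + d ^ 2 * mu * (ζ q ^ 2 * ‖pt u q‖ ^ 2)
          + C1 * (Qc0 (d := d) R).indicator (gradSq u) q) := by
      refine integral_mono ib.neg
        (((iY.const_mul _).add (iX.const_mul _)).add (iG.const_mul _)) fun q => ?_
      have ep : ∀ α, pd α (fun q => ζ q ^ 2 • pt u q) q
          = ζ q ^ 2 • pd α (pt u) q + (2 * ζ q * pd α ζ q) • pt u q := by
        intro α
        rw [pd_smul α hz2 hv, pd_pow α 2 hζ]
        simp
      simp only [bf, ep]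
      by_cases hq : q ∈ Qc0 R
      · rw [indicator_of_mem hq]
        exact pointwise_one hδ (hA.2 (q.2 0)) (fun β => pd β u q) (fun β => pd β (pt u) q)
          (pt u q) (ζ q) (hζ0 q) (fun α => pd α ζ q) L (fun α => hζd α q) lam mu hlam0 hmu0
      · rw [indicator_of_notMem hq]
        simp [zout q hq]
    have iYX : Integrable fun q =>
        d * lam * (ζ q ^ 4 * gradSq (pt u) q) + d ^ 2 * mu * (ζ q ^ 2 * ‖pt u q‖ ^ 2) :=
      (iY.const_mul _).add (iX.const_mul _)
    rw [integral_neg, integral_add iYX (iG.const_mul _),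
      integral_add (iY.const_mul _) (iX.const_mul _), integral_const_mul, integral_const_mul,
      integral_const_mul, eG] at hle
    linarith
  -- second test function
  have step2 : Y ≤ C2 * X := by
    have hz4 : ContDiff ℝ (⊤ : ℕ∞) fun q => ζ q ^ 4 := hζ.pow 4
    have hφ : ContDiff ℝ (⊤ : ℕ∞) fun q => ζ q ^ 4 • pt u q := hz4.smul hv
    have hφc : HasCompactSupport fun q => ζ q ^ 4 • pt u q :=
      hcs _ (by intro q h; simp [h])
    have h := eq_two hA hu hw hφ hφc (hts _ (by intro q h; simp [h]))
    have cvt := (pt_smooth hv).continuous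
    have i1 : Integrable fun q => ⟪pt u q, pt (fun q => ζ q ^ 4 • pt u q) q⟫ :=
      (cv.inner (pt_smooth hφ).continuous).integrable_of_hasCompactSupport
        ((pt_hcs hφc).mono' (fun q hq => subset_tsupport _ (fun h0 => hq (by simp [h0]))))
    have i2 : Integrable fun q => ζ q ^ 3 * pt ζ q * ‖pt u q‖ ^ 2 :=
      Continuous.integrable_of_hasCompactSupport (by fun_prop) (hcs _ (by intro q h; simp [h]))
    have ep : ∀ q, pt (fun q => ζ q ^ 4 • pt u q) q
        = ζ q ^ 4 • pt (pt u) q + (4 * ζ q ^ 3 * pt ζ q) • pt u q := by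
      intro q
      rw [pt_smul hz4 hv, pt_pow 4 hζ]
      simp
    -- integration by parts in time
    have hibp : ∫ q, (2 * ⟪pt u q, pt (fun q => ζ q ^ 4 • pt u q) q⟫
        - 4 * (ζ q ^ 3 * pt ζ q * ‖pt u q‖ ^ 2)) = 0 := by
      refine integral_line_zero (F := fun q => ⟪pt u q, ζ q ^ 4 • pt u q⟫)
        ((cv.inner hφ.continuous).integrable_of_hasCompactSupport
          (hcs _ (by intro q h; simp [h]))) ((i1.const_mul _).sub (i2.const_mul _)) fun q => ?_
      have a1 := pt_line hv q
      have a2 := pt_line hφ q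
      unfold HasLineDerivAt at a1 a2 ⊢
      have a3 := a1.inner ℝ a2
      simp only [zero_smul, add_zero] at a3
      have e : 2 * ⟪pt u q, pt (fun q => ζ q ^ 4 • pt u q) q⟫
          - 4 * (ζ q ^ 3 * pt ζ q * ‖pt u q‖ ^ 2)
          = ⟪pt u q, pt (fun q => ζ q ^ 4 • pt u q) q⟫ + ⟪pt (pt u) q, ζ q ^ 4 • pt u q⟫ := by
        rw [ep q]
        simp only [inner_add_right, real_inner_smul_right, real_inner_self_eq_norm_sq]
        rw [real_inner_comm (pt u q) (pt (pt u) q)]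
        ring
      rw [e]
      exact a3
    rw [integral_sub (i1.const_mul _) (i2.const_mul _), integral_const_mul, integral_const_mul,
      h] at hibp
    have hKX : ∫ q, ζ q ^ 3 * pt ζ q * ‖pt u q‖ ^ 2 ≤ K * X := by
      rw [hX, ← integral_const_mul]
      refine integral_mono i2 (iX.const_mul _) fun q => ?_
      have h3 : ζ q ^ 3 * pt ζ q ≤ K * ζ q ^ 2 := by
        rcases (hζ0 q).eq_or_lt with h0 | h0
        · simp [← h0]
        · have b1 := hζt q h0
          have b2 := hζ1 q
          calc ζ q ^ 3 * pt ζ q ≤ ζ q ^ 3 * K := by gcongr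
            _ = (K * ζ q ^ 2) * ζ q := by ring
            _ ≤ (K * ζ q ^ 2) * 1 := by gcongr
            _ = K * ζ q ^ 2 := mul_one _
      calc ζ q ^ 3 * pt ζ q * ‖pt u q‖ ^ 2 ≤ K * ζ q ^ 2 * ‖pt u q‖ ^ 2 := by gcongr
        _ = K * (ζ q ^ 2 * ‖pt u q‖ ^ 2) := by ring
    have ib : Integrable
        (bf Ab (fun α => pd α (pt u)) (fun α => pd α fun q => ζ q ^ 4 • pt u q)) :=
      bf_integrable hA (fun α => (hvd α).continuous)
        (fun α => (pd_smooth α hφ).continuous) (fun α => pd_hcs α hφc)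
    have hle : ∫ q, δ / 2 * (ζ q ^ 4 * gradSq (pt u) q) ≤
        ∫ q, (bf Ab (fun α => pd α (pt u)) (fun α => pd α fun q => ζ q ^ 4 • pt u q) q
          + 8 * d ^ 3 * L ^ 2 * δ⁻¹ ^ 3 * (ζ q ^ 2 * ‖pt u q‖ ^ 2)) := by
      refine integral_mono (iY.const_mul _) (ib.add (iX.const_mul _)) fun q => ?_
      have ep : ∀ α, pd α (fun q => ζ q ^ 4 • pt u q) q
          = ζ q ^ 4 • pd α (pt u) q + (4 * ζ q ^ 3 * pd α ζ q) • pt u q := by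
        intro α
        rw [pd_smul α hz4 hv, pd_pow α 4 hζ]
        simp
      simp only [bf, ep]
      exact pointwise_two hδ (hA.2 (q.2 0)) (fun β => pd β (pt u) q)
          (pt u q) (ζ q) (hζ0 q) (fun α => pd α ζ q) L (fun α => hζd α q)
    rw [integral_add ib (iX.const_mul _), integral_const_mul, integral_const_mul] at hle
    have hfin : δ / 2 * Y ≤ (2 * K + 8 * d ^ 3 * L ^ 2 * δ⁻¹ ^ 3) * X := by linarith
    calc Y = 2 / δ * (δ / 2 * Y) := by field_simp
      _ ≤ 2 / δ * ((2 * K + 8 * d ^ 3 * L ^ 2 * δ⁻¹ ^ 3) * X) := by gcongr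
      _ = C2 * X := by rw [hC2]; ring
  have s3 : d * lam * Y ≤ 1 / 4 * X := by
    calc d * lam * Y ≤ d * lam * (C2 * X) := by gcongr
      _ = 1 / 4 * (C2 / (C2 + 1)) * X := by rw [hlam]; field_simp
      _ ≤ 1 / 4 * 1 * X := by
          gcongr
          rw [div_le_one (by positivity)]; linarith
      _ = 1 / 4 * X := by ring
  have s4 : d ^ 2 * mu * X = 1 / 4 * X := by rw [hmu]; field_simp
  linarith

/-- For homogeneous systems with coefficients depending only on `x₁`,
the time derivative of a smooth weak solution in `Q_R` satisfies
`‖∂_t u‖_{L₂(Q_r)} ≤ N‖Du‖_{L₂(Q_R)}` with `N = N(d,m,δ,R,r)`. -/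
theorem stmt_7
    (d m : ℕ) [NeZero d] [NeZero m] (δ : ℝ) (hδ : δ ∈ Set.Ioc (0:ℝ) 1)
    (r R : ℝ) (hr : 0 < r) (hrR : r < R) :
    ∃ N : ℝ, 0 < N ∧
    ∀ (Ab : Fin d → Fin d → ℝ → CLM m), CoeffsOne δ Ab →
    ∀ u : ℝ × Ed d → Em m, ContDiff ℝ (⊤ : ℕ∞) u →
    -- `-u_t + D_α(Ā^{αβ}(x₁)D_βu) = 0` weakly in `Q_R`
    (∀ φt : ℝ × Ed d → Em m, ContDiff ℝ (⊤ : ℕ∞) φt → HasCompactSupport φt →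
      tsupport φt ⊆ Qc0 R →
      ∫ q, (⟪u q, pt φt q⟫ - ∑ α, ∑ β, ⟪Ab α β (q.2 0) (pd β u q), pd α φt q⟫) = 0) →
    Real.sqrt (∫ q in Qc0 (d := d) r, ‖pt u q‖ ^ 2)
      ≤ N * Real.sqrt (∫ q in Qc0 (d := d) R, gradSq u q) := by
  have hδ0 : 0 < δ := hδ.1
  have hR : 0 < R := hr.trans hrR
  have hr2 : r ^ 2 < R ^ 2 := by gcongr
  obtain ⟨s, hs1, hs2⟩ := exists_between hr2
  obtain ⟨ρ, hρ1, hρ2⟩ := exists_between hrR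
  -- spatial cutoff
  let b : ContDiffBump (0 : Ed d) := ⟨r, ρ, hr, hρ1⟩
  have hb : ContDiff ℝ (⊤ : ℕ∞) b := b.contDiff
  obtain ⟨L, hL⟩ := (b.hasCompactSupport.fderiv (𝕜 := ℝ)).exists_bound_of_continuous
    (hb.continuous_fderiv (by simp))
  -- time cutoff at the bottom
  let a1 : ℝ → ℝ := fun t => Real.smoothTransition ((t + s) / (s - r ^ 2))
  have ha1 : ContDiff ℝ (⊤ : ℕ∞) a1 :=
    Real.smoothTransition.contDiff.comp ((contDiff_id.add contDiff_const).div_const _)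
  obtain ⟨K, hK⟩ := (isCompact_Icc (a := -R ^ 2) (b := (0:ℝ))).exists_bound_of_continuousOn
    (ha1.continuous_deriv (by simp)).continuousOn
  obtain ⟨C, hC, hmain⟩ := main_est d m δ hδ0 R |K| L (abs_nonneg K)
  refine ⟨Real.sqrt C, Real.sqrt_pos.2 hC, ?_⟩
  intro Ab hA u hu hw
  rw [← Real.sqrt_mul hC.le]
  refine Real.sqrt_le_sqrt ?_
  have hcont : Continuous fun q => ‖pt u q‖ ^ 2 := (pt_smooth hu).continuous.norm.pow 2
  let S : ℕ → Set (ℝ × Ed d) := fun n => Ioo (0 - r ^ 2) (-(2 / ((n : ℝ) + 1))) ×ˢ ball 0 r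
  have hSU : ⋃ n, S n = Qc0 r := by
    ext q
    simp only [S, mem_iUnion, Qc0, Qc, mem_prod, mem_Ioo]
    constructor
    · rintro ⟨n, ⟨h1, h2⟩, h3⟩
      have : 0 < 2 / ((n : ℝ) + 1) := by positivity
      exact ⟨⟨h1, by linarith⟩, h3⟩
    · rintro ⟨⟨h1, h2⟩, h3⟩
      obtain ⟨n, hn⟩ := exists_nat_gt (2 / (-q.1))
      refine ⟨n, ⟨h1, ?_⟩, h3⟩
      have h4 : 0 < -q.1 := by linarith
      have h5 : 2 / ((n : ℝ) + 1) < -q.1 := by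
        rw [div_lt_iff₀ h4] at hn
        rw [div_lt_iff₀ (by positivity)]
        nlinarith
      linarith
  have hSm : Monotone S := by
    intro n k hnk
    refine Set.prod_mono (Ioo_subset_Ioo_right ?_) subset_rfl
    have : (n : ℝ) ≤ k := by exact_mod_cast hnk
    have : 2 / ((k : ℝ) + 1) ≤ 2 / ((n : ℝ) + 1) := by gcongr
    linarith
  have hSmeas : ∀ n, MeasurableSet (S n) := fun n => measurableSet_Ioo.prod measurableSet_ball
  have hlim := tendsto_setIntegral_of_monotone (μ := volume) (f := fun q => ‖pt u q‖ ^ 2)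
    hSmeas hSm (by rw [hSU]; exact integrableOn_Qc0 hcont r)
  rw [hSU] at hlim
  refine le_of_tendsto' hlim fun n => ?_
  -- time cutoff at the top
  set η : ℝ := 1 / ((n : ℝ) + 1) with hη
  have hη0 : 0 < η := by positivity
  have h2η : 2 / ((n : ℝ) + 1) = 2 * η := by rw [hη]; ring
  let a2 : ℝ → ℝ := fun t => Real.smoothTransition (-t / η - 1)
  have ha2 : ContDiff ℝ (⊤ : ℕ∞) a2 :=
    Real.smoothTransition.contDiff.comp ((contDiff_id.neg.div_const _).sub contDiff_const)
  have ha2anti : Antitone a2 := by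
    intro x y hxy
    apply Real.smoothTransition.monotone
    have : -y / η ≤ -x / η := by gcongr
    linarith
  let a : ℝ → ℝ := fun t => a1 t * a2 t
  have ha : ContDiff ℝ (⊤ : ℕ∞) a := ha1.mul ha2
  have ha0 : ∀ t, 0 ≤ a t := fun t =>
    mul_nonneg (Real.smoothTransition.nonneg _) (Real.smoothTransition.nonneg _)
  have ha1' : ∀ t, a t ≤ 1 := fun t =>
    mul_le_one₀ (Real.smoothTransition.le_one _) (Real.smoothTransition.nonneg _)
      (Real.smoothTransition.le_one _)
  have hasupp : ∀ t, a t ≠ 0 → t ∈ Icc (-s) (-η) := by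
    intro t ht
    have hA1 : a1 t ≠ 0 := left_ne_zero_of_mul ht
    have hA2 : a2 t ≠ 0 := right_ne_zero_of_mul ht
    constructor
    · by_contra hcon
      push Not at hcon
      refine hA1 (Real.smoothTransition.zero_of_nonpos ?_)
      exact div_nonpos_of_nonpos_of_nonneg (by linarith) (by linarith)
    · by_contra hcon
      push Not at hcon
      refine hA2 (Real.smoothTransition.zero_of_nonpos ?_)
      have : -t / η ≤ 1 := by rw [div_le_one hη0]; linarith
      linarith
  have haone : ∀ t, -r ^ 2 ≤ t → t ≤ -(2 * η) → a t = 1 := by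
    intro t h1 h2
    have e1 : a1 t = 1 := Real.smoothTransition.one_of_one_le (by
      rw [le_div_iff₀ (by linarith)]; linarith)
    have e2 : a2 t = 1 := Real.smoothTransition.one_of_one_le (by
      have : 2 ≤ -t / η := by rw [le_div_iff₀ hη0]; linarith
      linarith)
    simp [a, e1, e2]
  have hda : ∀ t, a t ≠ 0 → deriv a t ≤ |K| := by
    intro t ht
    have hmem := hasupp t ht
    have e : deriv a t = deriv a1 t * a2 t + a1 t * deriv a2 t :=
      deriv_fun_mul ((ha1.differentiable (by simp)) t) ((ha2.differentiable (by simp)) t)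
    have n1 : deriv a2 t ≤ 0 := ha2anti.deriv_nonpos
    have n2 : |deriv a1 t| ≤ K := hK t ⟨by linarith [hmem.1], by linarith [hmem.2]⟩
    have n3 : 0 ≤ a1 t := Real.smoothTransition.nonneg _
    have n4 : 0 ≤ a2 t := Real.smoothTransition.nonneg _
    have n5 : a2 t ≤ 1 := Real.smoothTransition.le_one _
    have n6 : deriv a1 t ≤ |K| := (le_abs_self _).trans (n2.trans (le_abs_self _))
    have n7 : deriv a1 t * a2 t ≤ |K| * 1 := by
      calc deriv a1 t * a2 t ≤ |K| * a2 t := by gcongr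
        _ ≤ |K| * 1 := by gcongr
    have n8 : a1 t * deriv a2 t ≤ 0 := mul_nonpos_of_nonneg_of_nonpos n3 n1
    linarith
  -- the cutoff function
  let ζ : ℝ × Ed d → ℝ := fun q => a q.1 * b q.2
  have hζ : ContDiff ℝ (⊤ : ℕ∞) ζ := (ha.comp contDiff_fst).mul (hb.comp contDiff_snd)
  have hζ' : ∀ q, HasFDerivAt ζ (a q.1 • (fderiv ℝ b q.2).comp (ContinuousLinearMap.snd ℝ ℝ (Ed d))
      + b q.2 • (fderiv ℝ a q.1).comp (ContinuousLinearMap.fst ℝ ℝ (Ed d))) q := by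
    intro q
    have f1 : HasFDerivAt (fun q : ℝ × Ed d => a q.1)
        ((fderiv ℝ a q.1).comp (ContinuousLinearMap.fst ℝ ℝ (Ed d))) q :=
      ((ha.differentiable (by simp)) q.1).hasFDerivAt.comp q hasFDerivAt_fst
    have f2 : HasFDerivAt (fun q : ℝ × Ed d => b q.2)
        ((fderiv ℝ b q.2).comp (ContinuousLinearMap.snd ℝ ℝ (Ed d))) q :=
      ((hb.differentiable (by simp)) q.2).hasFDerivAt.comp q hasFDerivAt_snd
    exact f1.mul f2
  have hζpt : ∀ q, pt ζ q = b q.2 * deriv a q.1 := by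
    intro q
    unfold pt
    rw [(hζ' q).fderiv]
    simp
  have hζpd : ∀ α q, pd α ζ q = a q.1 * fderiv ℝ b q.2 (EuclideanSpace.single α 1) := by
    intro α q
    unfold pd
    rw [(hζ' q).fderiv]
    simp
  have hsuppsub : support ζ ⊆ Icc (-s) (-η) ×ˢ closedBall (0 : Ed d) ρ := by
    intro q hq
    have g1 : a q.1 ≠ 0 := left_ne_zero_of_mul hq
    have g2 : b q.2 ≠ 0 := right_ne_zero_of_mul hq
    refine ⟨hasupp _ g1, ?_⟩
    have : q.2 ∈ support b := g2
    rw [b.support_eq] at this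
    exact ball_subset_closedBall this
  have hcomp : IsCompact (Icc (-s) (-η) ×ˢ closedBall (0 : Ed d) ρ) :=
    isCompact_Icc.prod (isCompact_closedBall _ _)
  have htsub : tsupport ζ ⊆ Icc (-s) (-η) ×ˢ closedBall (0 : Ed d) ρ :=
    closure_minimal hsuppsub hcomp.isClosed
  have hζc : HasCompactSupport ζ := hcomp.of_isClosed_subset (isClosed_tsupport _) htsub
  have hζs : tsupport ζ ⊆ Qc0 R := by
    intro q hq
    obtain ⟨h1, h2⟩ := htsub hq
    refine ⟨⟨by linarith [h1.1], by linarith [h1.2]⟩, ?_⟩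
    exact closedBall_subset_ball hρ2 h2
  have hζ0 : ∀ q, 0 ≤ ζ q := fun q => mul_nonneg (ha0 _) b.nonneg
  have hζ1 : ∀ q, ζ q ≤ 1 := fun q => mul_le_one₀ (ha1' _) b.nonneg b.le_one
  have hest := hmain Ab hA u hu hw ζ hζ hζc hζs hζ0 hζ1 (by
    intro q hq
    rw [hζpt]
    have g1 := hda q.1 (left_ne_zero_of_mul hq.ne')
    calc b q.2 * deriv a q.1 ≤ b q.2 * |K| := by
          have : 0 ≤ b q.2 := b.nonneg
          gcongr
      _ ≤ 1 * |K| := by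
          have : b q.2 ≤ 1 := b.le_one
          gcongr
      _ = |K| := one_mul _) (by
    intro α q
    rw [hζpd, abs_mul, abs_of_nonneg (ha0 _)]
    have g1 : |fderiv ℝ b q.2 (EuclideanSpace.single α 1)| ≤ L := by
      have := (fderiv ℝ b q.2).le_of_opNorm_le (hL q.2) (EuclideanSpace.single α 1)
      simpa using this
    calc a q.1 * |fderiv ℝ b q.2 (EuclideanSpace.single α 1)|
        ≤ 1 * |fderiv ℝ b q.2 (EuclideanSpace.single α 1)| := by
          have := ha1' q.1
          gcongr
      _ ≤ L := by rw [one_mul]; exact g1)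
  refine le_trans ?_ hest
  have iX : Integrable fun q => ζ q ^ 2 * ‖pt u q‖ ^ 2 :=
    ((hζ.continuous.pow 2).mul hcont).integrable_of_hasCompactSupport
      (hζc.mono' (fun q hq => subset_tsupport _ (fun h0 => hq (by simp [h0]))))
  calc ∫ q in S n, ‖pt u q‖ ^ 2 = ∫ q in S n, ζ q ^ 2 * ‖pt u q‖ ^ 2 := by
        refine setIntegral_congr_fun (hSmeas n) fun q hq => ?_
        obtain ⟨⟨h1, h2⟩, h3⟩ := hq
        have g1 : a q.1 = 1 := haone _ (by linarith) (by linarith)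
        have g2 : b q.2 = 1 := b.one_of_mem_closedBall (ball_subset_closedBall h3)
        simp [ζ, g1, g2]
    _ ≤ ∫ q, ζ q ^ 2 * ‖pt u q‖ ^ 2 :=
        setIntegral_le_integral iX (Filter.Eventually.of_forall fun q => by positivity)
end
end
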